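/- arXiv:2301.02154 — 2 statements merged into one kernel-verified Lean document; each statement's English description precedes it below -/
import Mathlib

section
/- There exists a constant c > 0 such that for every set Λ ⊆ ℕ with both Λ and ℕ∖Λ infinite, there exists a continuous quasiconvex function f_Λ : ℝ^{2×2} → ℝ of linear growth satisfying: (1) f_Λ(3^j·I) = 0 for all j ∈ Λ, and (2) there is J ∈ ℕ such that f_Λ(3^j·I) ≥ c·3^j for all j ∈ ℕ∖Λ with j ≥ J, where I denotes the 2×2 identity matrix. -/
open MeasureTheory

/-- The open unit cube `(0,1)^n` in `ℝⁿ`. -/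
def unitCube (n : ℕ) : Set (Fin n → ℝ) := Set.univ.pi fun _ => Set.Ioo (0 : ℝ) 1

/-- The Jacobian matrix of a map `φ : ℝⁿ → ℝᵐ` at a point `x`. -/
noncomputable def jacobianMatrix {m n : ℕ} (φ : (Fin n → ℝ) → (Fin m → ℝ))
    (x : Fin n → ℝ) : Matrix (Fin m) (Fin n) ℝ :=
  Matrix.of fun i j => fderiv ℝ φ x (Pi.single j 1) i

/-- A continuous function on `m×n` matrices is quasiconvex if it satisfies Jensen's
inequality against gradients of smooth compactly supported test maps on the unit cube. -/
def IsQuasiconvex {m n : ℕ} (f : Matrix (Fin m) (Fin n) ℝ → ℝ) : Prop :=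
  ∀ z : Matrix (Fin m) (Fin n) ℝ, ∀ φ : (Fin n → ℝ) → (Fin m → ℝ),
    ContDiff ℝ (⊤ : ℕ∞) φ → HasCompactSupport φ → tsupport φ ⊆ unitCube n →
    f z ≤ ∫ x in unitCube n, f (z + jacobianMatrix φ x)

/-- The Euclidean (Frobenius) norm of a matrix. -/
noncomputable def frobNorm {m n : ℕ} (z : Matrix (Fin m) (Fin n) ℝ) : ℝ :=
  Real.sqrt (∑ i, ∑ j, (z i j) ^ 2)

/-- `f` has linear growth. -/
def HasLinearGrowth {m n : ℕ} (f : Matrix (Fin m) (Fin n) ℝ → ℝ) : Prop :=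
  ∃ C : ℝ, 0 ≤ C ∧ ∀ z, |f z| ≤ C * (1 + frobNorm z)

/-- The metric `d(f,g) = sup_z |f(z)-g(z)|/(1+|z|)` on functions of linear growth. -/
noncomputable def dLG {m n : ℕ} (f g : Matrix (Fin m) (Fin n) ℝ → ℝ) : ℝ :=
  ⨆ z : Matrix (Fin m) (Fin n) ℝ, |f z - g z| / (1 + frobNorm z)


open Filter Topology Set
open scoped NNReal ENNReal

theorem LipschitzWith.integrable_lineDeriv {E : Type*} [NormedAddCommGroup E] [NormedSpace ℝ E]
    [MeasurableSpace E] [BorelSpace E] [FiniteDimensional ℝ E] {μ : Measure E}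
    [μ.IsAddHaarMeasure] {C : ℝ≥0} {f : E → ℝ} (hf : LipschitzWith C f)
    (hfc : HasCompactSupport f) (v : E) : Integrable (fun x => lineDeriv ℝ f x v) μ := by
  refine (integrableOn_iff_integrable_of_support_subset (s := tsupport f) ?_).1 ?_
  · intro x hx
    by_contra hxs
    apply hx
    have h0 : f =ᶠ[𝓝 x] fun _ => 0 := notMem_tsupport_iff_eventuallyEq.1 hxs
    change lineDeriv ℝ f x v = 0
    rw [h0.lineDeriv_eq]
    simp [lineDeriv]
  · exact Measure.integrableOn_of_bounded (M := C * ‖v‖) hfc.isCompact.measure_lt_top.ne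
      (aestronglyMeasurable_lineDeriv hf.continuous μ)
      (.of_forall fun x => norm_lineDeriv_le_of_lipschitz ℝ hf)

theorem LipschitzWith.integral_lineDeriv_mul_lineDeriv_comm {E : Type*} [NormedAddCommGroup E]
    [NormedSpace ℝ E] [MeasurableSpace E] [BorelSpace E] [FiniteDimensional ℝ E] {μ : Measure E}
    [μ.IsAddHaarMeasure] {C D : ℝ≥0} {f g : E → ℝ} (hf : LipschitzWith C f)
    (hg : LipschitzWith D g) (hfc : HasCompactSupport f) (hgc : HasCompactSupport g) (v w : E) :
    ∫ x, lineDeriv ℝ f x v * lineDeriv ℝ g x w ∂μ =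
      ∫ x, lineDeriv ℝ f x w * lineDeriv ℝ g x v ∂μ := by
  have hA := hg.integral_inv_smul_sub_mul_tendsto_integral_lineDeriv_mul
    (hf.integrable_lineDeriv (μ := μ) hfc v) w
  have hB := hf.integral_inv_smul_sub_mul_tendsto_integral_lineDeriv_mul
    (hg.integrable_lineDeriv (μ := μ) hgc (-v)) (-w)
  have key : ∀ t : ℝ, ∫ x, (t⁻¹ • (g (x + t • w) - g x)) * lineDeriv ℝ f x v ∂μ =
      ∫ x, (t⁻¹ • (f (x + t • (-w)) - f x)) * lineDeriv ℝ g x (-v) ∂μ := by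
    intro t
    have hg1 : LipschitzWith D (fun x => g (x + t • w)) := by
      have := hg.comp ((LipschitzWith.id (α := E)).add (LipschitzWith.const (t • w)))
      simpa [Function.comp_def] using this
    have hgc1 : HasCompactSupport (fun x => g (x + t • w)) :=
      hgc.comp_homeomorph (Homeomorph.addRight (t • w))
    have I1 := hf.integral_lineDeriv_mul_eq (μ := μ) hg1 hgc1 v
    have I2 := hf.integral_lineDeriv_mul_eq (μ := μ) hg hgc v
    have hl : ∀ x, lineDeriv ℝ (fun x => g (x + t • w)) x (-v) =
        lineDeriv ℝ g (x + t • w) (-v) := by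
      intro x
      simp only [lineDeriv]
      congr 1
      ext s
      congr 1
      abel
    simp only [hl] at I1
    have I3 : ∫ x, lineDeriv ℝ g (x + t • w) (-v) * f x ∂μ =
        ∫ x, lineDeriv ℝ g x (-v) * f (x + t • (-w)) ∂μ := by
      rw [← integral_add_right_eq_self
        (fun x => lineDeriv ℝ g x (-v) * f (x + t • (-w))) (t • w)]
      simp
    have hf1 : HasCompactSupport (fun x => f (x + t • (-w))) :=
      hfc.comp_homeomorph (Homeomorph.addRight (t • (-w)))
    obtain ⟨Mf, hMf⟩ := hf.continuous.bounded_above_of_compact_support hfc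
    obtain ⟨Mg, hMg⟩ := hg.continuous.bounded_above_of_compact_support hgc
    have if1 : Integrable (fun x => lineDeriv ℝ f x v * g (x + t • w)) μ :=
      (hf.integrable_lineDeriv hfc v).mul_bdd (c := Mg) hg1.continuous.aestronglyMeasurable
        (.of_forall fun x => hMg _)
    have if2 : Integrable (fun x => lineDeriv ℝ f x v * g x) μ :=
      (hf.integrable_lineDeriv hfc v).mul_bdd (c := Mg) hg.continuous.aestronglyMeasurable
        (.of_forall fun x => hMg _)
    have ig1 : Integrable (fun x => lineDeriv ℝ g x (-v) * f (x + t • (-w))) μ :=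
      (hg.integrable_lineDeriv hgc (-v)).mul_bdd (c := Mf)
        (hf.continuous.comp (continuous_add_const _)).aestronglyMeasurable
        (.of_forall fun x => hMf _)
    have ig2 : Integrable (fun x => lineDeriv ℝ g x (-v) * f x) μ :=
      (hg.integrable_lineDeriv hgc (-v)).mul_bdd (c := Mf) hf.continuous.aestronglyMeasurable
        (.of_forall fun x => hMf _)
    calc ∫ x, (t⁻¹ • (g (x + t • w) - g x)) * lineDeriv ℝ f x v ∂μ
        = t⁻¹ * ∫ x, (lineDeriv ℝ f x v * g (x + t • w) - lineDeriv ℝ f x v * g x) ∂μ := by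
          rw [← integral_const_mul]
          congr 1; ext x; simp only [smul_eq_mul]; ring
      _ = t⁻¹ * ∫ x, (lineDeriv ℝ g x (-v) * f (x + t • (-w)) -
            lineDeriv ℝ g x (-v) * f x) ∂μ := by
          rw [integral_sub if1 if2, integral_sub ig1 ig2, I1, I2, I3]
      _ = _ := by
          rw [← integral_const_mul]
          congr 1; ext x; simp only [smul_eq_mul]; ring
  simp only [key] at hA
  have := tendsto_nhds_unique hA hB
  calc ∫ x, lineDeriv ℝ f x v * lineDeriv ℝ g x w ∂μ
      = ∫ x, lineDeriv ℝ g x w * lineDeriv ℝ f x v ∂μ := by simp only [mul_comm]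
    _ = _ := by rw [this]; simp [lineDeriv_neg]

theorem sq_mul_setIntegral_closedBall_comp_sub_smul (H : (Fin 2 → ℝ) → ℝ) (x : Fin 2 → ℝ) {s : ℝ}
    (hs : 0 < s) :
    s ^ 2 * ∫ y in Metric.closedBall (0 : Fin 2 → ℝ) 1, H (x - s • y) =
      ∫ y in Metric.closedBall x s, H y := by
  have h1 : ∀ y : Fin 2 → ℝ, (Metric.closedBall (0 : Fin 2 → ℝ) 1).indicator
      (fun y => H (x - s • y)) y = (fun z => (Metric.closedBall x s).indicator H (x - z)) (s • y) := by
    intro y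
    have : y ∈ Metric.closedBall (0 : Fin 2 → ℝ) 1 ↔ x - s • y ∈ Metric.closedBall x s := by
      simp [dist_eq_norm, norm_smul, abs_of_pos hs, mul_le_iff_le_one_right hs]
    by_cases hy : y ∈ Metric.closedBall (0 : Fin 2 → ℝ) 1
    · rw [indicator_of_mem hy]
      simp only
      rw [indicator_of_mem (this.1 hy)]
    · rw [indicator_of_notMem hy]
      simp only
      rw [indicator_of_notMem (fun h => hy (this.2 h))]
  rw [← integral_indicator measurableSet_closedBall,
    ← integral_indicator measurableSet_closedBall]
  simp_rw [h1]
  rw [Measure.integral_comp_smul volume (fun z => (Metric.closedBall x s).indicator H (x - z)) s,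
    integral_sub_left_eq_self (fun z => (Metric.closedBall x s).indicator H z) volume x]
  simp only [Module.finrank_fintype_fun_eq_card, Fintype.card_fin, smul_eq_mul]
  rw [abs_of_pos (by positivity), ← mul_assoc, mul_inv_cancel₀ (by positivity), one_mul]

/-- A `1`-Lipschitz choice of radius at which the local averages of `H` are bounded by one, and
which vanishes outside a set whose volume is controlled by the integral of `H`. -/
theorem exists_lipschitz_averaging_radius {H : (Fin 2 → ℝ) → ℝ} (hc : Continuous H)
    (h0 : ∀ x, 0 ≤ H x) (hi : Integrable H) :
    ∃ r : (Fin 2 → ℝ) → ℝ, LipschitzWith 1 r ∧ (∀ x, 0 ≤ r x) ∧ (∃ S, ∀ x, r x ≤ S) ∧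
      (∀ x, ∫ y in Metric.closedBall (0 : Fin 2 → ℝ) 1, H (x - r x • y) ≤ 1) ∧
      volume {x | 0 < r x} ≤ ENNReal.ofReal (64 * ∫ x, H x) := by
  set N : (Fin 2 → ℝ) → ℝ → ℝ := fun x s =>
    ∫ y in Metric.closedBall (0 : Fin 2 → ℝ) 1, H (x - s • y) with hN
  have hNc : ∀ x, Continuous (N x) := by
    intro x
    refine continuous_parametric_integral_of_continuous ?_ (isCompact_closedBall _ _)
    simp only [Function.uncurry_def]
    fun_prop
  set T : Set ((Fin 2 → ℝ) × ℝ) := {p | 0 < p.2 ∧ 1 < N p.1 p.2} with hT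
  have hT1 : ∀ p ∈ T, p.2 ^ 2 < ∫ y in Metric.closedBall p.1 p.2, H y := by
    intro p hp
    rw [← sq_mul_setIntegral_closedBall_comp_sub_smul H p.1 hp.1]
    have := pow_pos hp.1 2
    exact lt_mul_of_one_lt_right this hp.2
  set S := Real.sqrt (∫ x, H x) with hS
  have hTS : ∀ p ∈ T, p.2 ≤ S := by
    intro p hp
    refine Real.le_sqrt_of_sq_le ((hT1 p hp).le.trans ?_)
    exact setIntegral_le_integral hi (.of_forall h0)
  classical
  set F : (Fin 2 → ℝ) × ℝ → (Fin 2 → ℝ) → ℝ := fun p x =>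
    if p ∈ T then max 0 (p.2 - dist x p.1) else 0 with hF
  have hF0 : ∀ p x, 0 ≤ F p x := by
    intro p x
    simp only [hF]
    split_ifs
    · exact le_max_left _ _
    · exact le_rfl
  have hFS : ∀ p x, F p x ≤ S := by
    intro p x
    simp only [hF]
    split_ifs with h
    · refine max_le (Real.sqrt_nonneg _) ?_
      linarith [hTS p h, dist_nonneg (x := x) (y := p.1)]
    · exact Real.sqrt_nonneg _
  have hFb : ∀ x, BddAbove (range fun p => F p x) := by
    intro x
    refine ⟨S, ?_⟩
    rintro _ ⟨p, rfl⟩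
    exact hFS p x
  have hFl : ∀ p x y, F p x ≤ F p y + dist x y := by
    intro p x y
    have := dist_triangle_left y p.1 x
    simp only [hF]
    split_ifs
    · refine max_le ?_ ?_
      · have := le_max_left 0 (p.2 - dist y p.1)
        linarith [dist_nonneg (x := x) (y := y)]
      · have := le_max_right 0 (p.2 - dist y p.1)
        linarith
    · linarith [dist_nonneg (x := x) (y := y)]
  set r : (Fin 2 → ℝ) → ℝ := fun x => ⨆ p, F p x with hr
  have hrT : ∀ p ∈ T, p.2 ≤ r p.1 := by
    intro p hp
    refine le_trans ?_ (le_ciSup (hFb p.1) p)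
    simp [hF, hp]
  have hrpos : ∀ x, 0 < r x → ∃ p ∈ T, dist x p.1 < p.2 := by
    intro x hx
    obtain ⟨p, hp⟩ := exists_lt_of_lt_ciSup hx
    simp only [hF] at hp
    split_ifs at hp with h
    · refine ⟨p, h, ?_⟩
      rcases lt_max_iff.1 hp with h' | h'
      · exact absurd h' (lt_irrefl _)
      · linarith
    · exact absurd hp (lt_irrefl _)
  have hr0 : ∀ x, 0 ≤ r x := fun x => Real.iSup_nonneg fun p => hF0 p x
  refine ⟨r, ?_, hr0, ⟨S, fun x => ciSup_le fun p => hFS p x⟩, ?_, ?_⟩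
  · refine LipschitzWith.of_le_add fun x y => ?_
    refine ciSup_le fun p => (hFl p x y).trans ?_
    gcongr
    exact le_ciSup (hFb y) p
  · intro x
    have hlim : Tendsto (N x) (𝓝[>] (r x)) (𝓝 (N x (r x))) :=
      ((hNc x).tendsto _).mono_left nhdsWithin_le_nhds
    refine le_of_tendsto hlim ?_
    filter_upwards [self_mem_nhdsWithin] with s hs
    by_contra! hlt
    have hs' : r x < s := hs
    exact absurd (hrT (x, s) ⟨(hr0 x).trans_lt hs', hlt⟩) (not_le.2 hs')
  · obtain ⟨u, huT, hud, hu⟩ := Vitali.exists_disjoint_subfamily_covering_enlargement_closedBall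
      T Prod.fst Prod.snd S hTS 4 (by norm_num)
    have huc : u.Countable := by
      refine hud.countable_of_nonempty_interior fun p hp => ?_
      exact ⟨p.1, Metric.ball_subset_interior_closedBall (Metric.mem_ball_self (huT hp).1)⟩
    have hcov : {x | 0 < r x} ⊆ ⋃ p ∈ u, Metric.closedBall p.1 (4 * p.2) := by
      intro x hx
      obtain ⟨p, hp, hxp⟩ := hrpos x hx
      obtain ⟨b, hb, hpb⟩ := hu p hp
      exact mem_biUnion hb (hpb (Metric.mem_closedBall.2 hxp.le))
    calc volume {x | 0 < r x}
        ≤ ∑' p : u, volume (Metric.closedBall p.1.1 (4 * p.1.2)) :=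
          (measure_mono hcov).trans (measure_biUnion_le _ huc _)
      _ ≤ ∑' p : u, ENNReal.ofReal 64 *
            ∫⁻ x in Metric.closedBall p.1.1 p.1.2, ENNReal.ofReal (H x) := by
          refine ENNReal.tsum_le_tsum fun p => ?_
          have hp := huT p.2
          rw [Real.volume_pi_closedBall _ (by linarith [hp.1]),
            ← ofReal_integral_eq_lintegral_ofReal hi.integrableOn (.of_forall h0),
            ← ENNReal.ofReal_mul (by norm_num)]
          refine ENNReal.ofReal_le_ofReal ?_
          have := hT1 _ hp
          simp only [Fintype.card_fin]
          nlinarith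
      _ = ENNReal.ofReal 64 *
            ∫⁻ x in ⋃ p ∈ u, Metric.closedBall p.1 p.2, ENNReal.ofReal (H x) := by
          rw [ENNReal.tsum_mul_left,
            lintegral_biUnion huc (fun p _ => measurableSet_closedBall) hud]
      _ ≤ ENNReal.ofReal 64 * ∫⁻ x, ENNReal.ofReal (H x) := by
          gcongr
          exact Measure.restrict_le_self
      _ = ENNReal.ofReal (64 * ∫ x, H x) := by
          rw [ENNReal.ofReal_mul (by norm_num),
            ofReal_integral_eq_lintegral_ofReal hi (.of_forall h0)]

theorem hasDerivAt_max_zero_sq (t : ℝ) :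
    HasDerivAt (fun t : ℝ => (max 0 t) ^ 2) (2 * max 0 t) t := by
  have key : ∀ y : ℝ, y ≠ 0 → HasDerivAt (fun t : ℝ => (max 0 t) ^ 2) (2 * max 0 y) y := by
    intro y hy
    rcases lt_or_gt_of_ne hy with h | h
    · have h1 : (fun t : ℝ => (max 0 t) ^ 2) =ᶠ[𝓝 y] fun _ => 0 := by
        filter_upwards [Iio_mem_nhds h] with t ht
        simp [max_eq_left (le_of_lt (mem_Iio.1 ht))]
      rw [max_eq_left h.le, mul_zero]
      exact (hasDerivAt_const y (0 : ℝ)).congr_of_eventuallyEq h1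
    · have h1 : (fun t : ℝ => (max 0 t) ^ 2) =ᶠ[𝓝 y] fun t => t ^ 2 := by
        filter_upwards [Ioi_mem_nhds h] with t ht
        simp [max_eq_right (le_of_lt (mem_Ioi.1 ht))]
      rw [max_eq_right h.le]
      have := (hasDerivAt_pow 2 y).congr_of_eventuallyEq h1
      simpa using this
  rcases eq_or_ne t 0 with rfl | h
  · exact hasDerivAt_of_hasDerivAt_of_ne (g := fun y => 2 * max 0 y) key
      (by fun_prop) (by fun_prop)
  · exact key t h

/-- A radial averaging kernel `ρ` whose first moments `ρ y * y k` are the partial derivatives of a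
compactly supported Lipschitz function `Θ`. -/
theorem exists_radial_kernel : ∃ (ρ Θ : (Fin 2 → ℝ) → ℝ) (c : ℝ) (D : ℝ≥0), Continuous ρ ∧
    (∀ y, y ∉ Metric.closedBall (0 : Fin 2 → ℝ) 1 → ρ y = 0) ∧ (∀ y, |ρ y| ≤ c) ∧
    ∫ y, ρ y = 1 ∧ LipschitzWith D Θ ∧ HasCompactSupport Θ ∧
    ∀ y k, lineDeriv ℝ Θ y (Pi.single k 1) = ρ y * y k := by
  set q : (Fin 2 → ℝ) → ℝ := fun y => max 0 (1 - y 0 ^ 2 - y 1 ^ 2) with hq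
  have hqc : Continuous q := by fun_prop
  have hq0 : ∀ y, 0 ≤ q y := fun y => le_max_left _ _
  have hq1 : ∀ y, q y ≤ 1 := fun y => max_le zero_le_one (by nlinarith)
  have hqs : ∀ y, y ∉ Metric.closedBall (0 : Fin 2 → ℝ) 1 → q y = 0 := by
    intro y hy
    simp only [hq]
    refine max_eq_left ?_
    by_contra! hlt
    refine hy ?_
    rw [mem_closedBall_zero_iff, pi_norm_le_iff_of_nonneg zero_le_one]
    intro i
    rw [Real.norm_eq_abs, ← sq_le_one_iff_abs_le_one]
    have h0 := sq_nonneg (y 0)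
    have h1 := sq_nonneg (y 1)
    fin_cases i
    · change y 0 ^ 2 ≤ 1
      linarith
    · change y 1 ^ 2 ≤ 1
      linarith
  have hqcs : HasCompactSupport q :=
    HasCompactSupport.intro (isCompact_closedBall _ _) hqs
  have hqi : Integrable q := hqc.integrable_of_hasCompactSupport hqcs
  have hpos : 0 < ∫ y, q y := by
    refine hqc.integral_pos_of_hasCompactSupport_nonneg_nonzero hqcs hq0 (x := 0) ?_
    simp [hq]
  set c := (∫ y, q y)⁻¹ with hcdef
  have hc : 0 < c := inv_pos.2 hpos
  have hd : ∀ y, HasFDerivAt (fun y => -(c / 4) * q y ^ 2)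
      ((-(c / 4)) • ((2 * q y) • (-((2 * y 0) • ContinuousLinearMap.proj (R := ℝ) (φ := fun _ : Fin 2 => ℝ) 0)
        - (2 * y 1) • ContinuousLinearMap.proj (R := ℝ) (φ := fun _ : Fin 2 => ℝ) 1))) y := by
    intro y
    have h0 : HasFDerivAt (fun y : Fin 2 → ℝ => y 0 ^ 2)
        ((2 * y 0) • ContinuousLinearMap.proj (R := ℝ) (φ := fun _ : Fin 2 => ℝ) 0) y := by
      simpa using (hasFDerivAt_apply (𝕜 := ℝ) (0 : Fin 2) y).pow 2
    have h1 : HasFDerivAt (fun y : Fin 2 → ℝ => y 1 ^ 2)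
        ((2 * y 1) • ContinuousLinearMap.proj (R := ℝ) (φ := fun _ : Fin 2 => ℝ) 1) y := by
      simpa using (hasFDerivAt_apply (𝕜 := ℝ) (1 : Fin 2) y).pow 2
    exact ((hasDerivAt_max_zero_sq _).comp_hasFDerivAt y ((h0.const_sub 1).sub h1)).const_mul _
  have hΘcs : HasCompactSupport (fun y => -(c / 4) * q y ^ 2) :=
    HasCompactSupport.intro (isCompact_closedBall (0 : Fin 2 → ℝ) 1)
      fun y hy => by simp [hqs y hy]
  have hΘ : ContDiff ℝ 1 (fun y => -(c / 4) * q y ^ 2) := by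
    rw [contDiff_one_iff_hasFDerivAt]
    exact ⟨_, by fun_prop, hd⟩
  obtain ⟨D, hD⟩ := hΘ.lipschitzWith_of_hasCompactSupport hΘcs one_ne_zero
  refine ⟨fun y => c * q y, fun y => -(c / 4) * q y ^ 2, c, D, by fun_prop,
    fun y hy => by simp [hqs y hy], fun y => ?_, ?_, hD, hΘcs, fun y k => ?_⟩
  · rw [abs_of_nonneg (mul_nonneg hc.le (hq0 y))]
    exact mul_le_of_le_one_right hc.le (hq1 y)
  · rw [integral_const_mul, hcdef, inv_mul_cancel₀ hpos.ne']
  · rw [(hd y).differentiableAt.lineDeriv_eq_fderiv, (hd y).fderiv]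
    fin_cases k <;> simp <;> ring

theorem dist_sub_smul_sub_smul_le {E : Type*} [NormedAddCommGroup E] [NormedSpace ℝ E] {r : E → ℝ}
    (hr : LipschitzWith 1 r) (a b y : E) :
    dist (a - r a • y) (b - r b • y) ≤ (1 + ‖y‖) * dist a b := by
  have h2 := hr.dist_le_mul a b
  rw [Real.dist_eq] at h2
  calc dist (a - r a • y) (b - r b • y) = ‖(a - b) - (r a - r b) • y‖ := by
        rw [dist_eq_norm]; congr 1; rw [sub_smul]; abel
    _ ≤ ‖a - b‖ + ‖(r a - r b) • y‖ := norm_sub_le _ _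
    _ = dist a b + |r a - r b| * ‖y‖ := by
        rw [norm_smul, dist_eq_norm, Real.norm_eq_abs]
    _ ≤ dist a b + dist a b * ‖y‖ := by
        gcongr
        simpa using h2
    _ = (1 + ‖y‖) * dist a b := by ring

section Mollification

variable {ρ u r : (Fin 2 → ℝ) → ℝ}

theorem differentiableAt_integral_mul_comp_sub_smul (hρ : Continuous ρ) (hρc : HasCompactSupport ρ)
    (hu : ContDiff ℝ 1 u) (huc : HasCompactSupport u) (hr : LipschitzWith 1 r) {x : Fin 2 → ℝ}
    (hx : DifferentiableAt ℝ r x) (v : Fin 2 → ℝ) :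
    DifferentiableAt ℝ (fun x => ∫ y, ρ y * u (x - r x • y)) x ∧
    fderiv ℝ (fun x => ∫ y, ρ y * u (x - r x • y)) x v =
      ∫ y, ρ y * fderiv ℝ u (x - r x • y) (v - fderiv ℝ r x v • y) := by
  obtain ⟨L, hL⟩ := hu.lipschitzWith_of_hasCompactSupport huc one_ne_zero
  have hr' := hr.continuous
  have hud : ∀ x, HasFDerivAt u (fderiv ℝ u x) x := fun x =>
    (hu.differentiable one_ne_zero x).hasFDerivAt
  have hud' : Continuous (fderiv ℝ u) := hu.continuous_fderiv one_ne_zero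
  have huc' := hu.continuous
  have hρi : Integrable ρ := hρ.integrable_of_hasCompactSupport hρc
  set F' : (Fin 2 → ℝ) → ((Fin 2 → ℝ) →L[ℝ] ℝ) := fun y =>
    ρ y • (fderiv ℝ u (x - r x • y)).comp
      (ContinuousLinearMap.id ℝ (Fin 2 → ℝ) - (fderiv ℝ r x).smulRight y) with hF'
  have hF'c : Continuous F' := by
    have hcs : Continuous fun y => (fderiv ℝ r x).smulRight y :=
      ((ContinuousLinearMap.smulRightL ℝ (Fin 2 → ℝ) (Fin 2 → ℝ)) (fderiv ℝ r x)).continuous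
    refine hρ.smul (Continuous.clm_comp (by fun_prop) (continuous_const.sub hcs))
  have hF'i : Integrable F' :=
    hF'c.integrable_of_hasCompactSupport hρc.smul_right
  have hmain := hasFDerivAt_integral_of_dominated_loc_of_lip (μ := volume)
    (F := fun x y => ρ y * u (x - r x • y)) (F' := F') (x₀ := x) (s := univ)
    (bound := fun y => |ρ y| * (L * (1 + ‖y‖))) univ_mem
    (.of_forall fun x' => by
      exact Continuous.aestronglyMeasurable (by fun_prop))
    (by
      refine Continuous.integrable_of_hasCompactSupport (by fun_prop) hρc.mul_right)
    hF'c.aestronglyMeasurable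
    (.of_forall fun y => by
      refine LipschitzOnWith.of_dist_le_mul fun a _ b _ => ?_
      rw [Real.coe_nnabs, abs_of_nonneg (a := |ρ y| * (L * (1 + ‖y‖))) (by positivity),
        Real.dist_eq, ← mul_sub, abs_mul, mul_assoc]
      gcongr
      have h1 := hL.dist_le_mul (a - r a • y) (b - r b • y)
      rw [Real.dist_eq] at h1
      refine h1.trans ?_
      rw [mul_assoc]
      gcongr
      exact dist_sub_smul_sub_smul_le hr a b y)
    (by
      refine Continuous.integrable_of_hasCompactSupport (by fun_prop) ?_
      exact HasCompactSupport.mul_right (hρc.comp_left (g := fun t => |t|) abs_zero))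
    (.of_forall fun y => by
      have h1 : HasFDerivAt (fun x' => x' - r x' • y)
          (ContinuousLinearMap.id ℝ (Fin 2 → ℝ) - (fderiv ℝ r x).smulRight y) x :=
        (hasFDerivAt_id x).sub (hx.hasFDerivAt.smul_const y)
      exact ((hud (x - r x • y)).comp x h1).const_mul (ρ y))
  refine ⟨hmain.2.differentiableAt, ?_⟩
  rw [hmain.2.fderiv, ContinuousLinearMap.integral_apply hF'i]
  simp [hF']

theorem lipschitzWith_integral_mul_comp_sub_smul (hρ : Continuous ρ) (hρc : HasCompactSupport ρ)
    {L : ℝ≥0} (hL : LipschitzWith L u) (hr : LipschitzWith 1 r) :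
    ∃ K, LipschitzWith K fun x => ∫ y, ρ y * u (x - r x • y) := by
  have hu := hL.continuous
  refine ⟨Real.toNNReal (∫ y, |ρ y| * (L * (1 + ‖y‖))), LipschitzWith.of_dist_le_mul fun a b => ?_⟩
  have hi : ∀ x, Integrable fun y => ρ y * u (x - r x • y) := fun x =>
    Continuous.integrable_of_hasCompactSupport (by fun_prop) hρc.mul_right
  rw [Real.coe_toNNReal _ (integral_nonneg fun y => by positivity), Real.dist_eq,
    ← integral_sub (hi a) (hi b), ← integral_mul_const, ← Real.norm_eq_abs]
  refine norm_integral_le_of_norm_le ?_ (.of_forall fun y => ?_)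
  · refine Continuous.integrable_of_hasCompactSupport (by fun_prop) ?_
    exact HasCompactSupport.mul_right
      (HasCompactSupport.mul_right (hρc.comp_left (g := fun t => |t|) abs_zero))
  rw [Real.norm_eq_abs, ← mul_sub, abs_mul, mul_assoc]
  gcongr
  have h1 := hL.dist_le_mul (a - r a • y) (b - r b • y)
  rw [Real.dist_eq] at h1
  refine h1.trans ?_
  rw [mul_assoc]
  gcongr
  exact dist_sub_smul_sub_smul_le hr a b y

theorem hasCompactSupport_integral_mul_comp_sub_smul
    (hρ : ∀ y, y ∉ Metric.closedBall (0 : Fin 2 → ℝ) 1 → ρ y = 0) (huc : HasCompactSupport u)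
    (hr0 : ∀ x, 0 ≤ r x) {S : ℝ} (hrS : ∀ x, r x ≤ S) :
    HasCompactSupport fun x => ∫ y, ρ y * u (x - r x • y) := by
  obtain ⟨R, hR⟩ := huc.isCompact.isBounded.subset_closedBall (0 : Fin 2 → ℝ)
  refine HasCompactSupport.intro (isCompact_closedBall (0 : Fin 2 → ℝ) (R + S)) fun x hx => ?_
  refine integral_eq_zero_of_ae (.of_forall fun y => ?_)
  by_cases hy : y ∈ Metric.closedBall (0 : Fin 2 → ℝ) 1
  · have : u (x - r x • y) = 0 := by
      by_contra hne
      have h1 := hR (subset_tsupport u hne)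
      refine hx ?_
      rw [mem_closedBall_zero_iff] at h1 hy ⊢
      have h2 : ‖r x • y‖ ≤ S := by
        rw [norm_smul, Real.norm_eq_abs, abs_of_nonneg (hr0 x)]
        exact (mul_le_of_le_one_right (hr0 x) hy).trans (hrS x)
      calc ‖x‖ = ‖(x - r x • y) + r x • y‖ := by simp
        _ ≤ _ := (norm_add_le _ _).trans (add_le_add h1 h2)
    simp [this]
  · simp [hρ y hy]

end Mollification

theorem abs_integral_le_mul_setIntegral {F G : (Fin 2 → ℝ) → ℝ} {s : Set (Fin 2 → ℝ)} {c : ℝ}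
    (hs : MeasurableSet s) (hG : IntegrableOn G s) (h : ∀ y ∈ s, |F y| ≤ c * G y)
    (h0 : ∀ y, y ∉ s → F y = 0) : |∫ y, F y| ≤ c * ∫ y in s, G y := by
  rw [← setIntegral_eq_integral_of_forall_compl_eq_zero h0, ← integral_const_mul,
    ← Real.norm_eq_abs]
  refine norm_integral_le_of_norm_le (hG.const_mul c) ?_
  filter_upwards [ae_restrict_mem hs] with y hy using h y hy

section Moment

variable {ρ Θ u v : (Fin 2 → ℝ) → ℝ} {c : ℝ} {D : ℝ≥0}

theorem integral_fderiv_comp_sub_smul_mul_comm (hΘ : LipschitzWith D Θ) (hΘc : HasCompactSupport Θ)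
    (hd : ∀ y k, lineDeriv ℝ Θ y (Pi.single k 1) = ρ y * y k)
    (hu : ContDiff ℝ 1 u) (huc : HasCompactSupport u) (x : Fin 2 → ℝ) {s : ℝ} (hs : 0 < s)
    (i j : Fin 2) :
    ∫ y, fderiv ℝ u (x - s • y) (Pi.single i 1) * (ρ y * y j) =
      ∫ y, fderiv ℝ u (x - s • y) (Pi.single j 1) * (ρ y * y i) := by
  have hf : ContDiff ℝ 1 fun y => u (x - s • y) := by fun_prop
  have hfc : HasCompactSupport fun y => u (x - s • y) :=
    huc.comp_homeomorph ((Homeomorph.smulOfNeZero s hs.ne').trans (Homeomorph.subLeft x))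
  obtain ⟨L, hL⟩ := hf.lipschitzWith_of_hasCompactSupport hfc one_ne_zero
  have hl : ∀ y w, lineDeriv ℝ (fun y => u (x - s • y)) y w =
      -s * fderiv ℝ u (x - s • y) w := by
    intro y w
    have h1 : HasFDerivAt (fun y => x - s • y) (-(s • ContinuousLinearMap.id ℝ (Fin 2 → ℝ))) y :=
      ((hasFDerivAt_id y).const_smul s).const_sub x
    have h2 := ((hu.differentiable one_ne_zero (x - s • y)).hasFDerivAt).comp y h1
    have h3 : fderiv ℝ (fun y => u (x - s • y)) y = _ := h2.fderiv
    rw [(hf.differentiable one_ne_zero y).lineDeriv_eq_fderiv, h3]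
    simp
  have key := hL.integral_lineDeriv_mul_lineDeriv_comm (μ := volume) hΘ hfc hΘc
    (Pi.single i 1) (Pi.single j 1)
  simp only [hl, hd, mul_assoc] at key
  rw [integral_const_mul, integral_const_mul] at key
  exact mul_left_cancel₀ (neg_ne_zero.2 hs.ne') key

theorem fderiv_apply_fin_two (u : (Fin 2 → ℝ) → ℝ) (x y : Fin 2 → ℝ) :
    fderiv ℝ u x y = y 0 * fderiv ℝ u x (Pi.single 0 1) + y 1 * fderiv ℝ u x (Pi.single 1 1) := by
  conv_lhs => rw [pi_eq_sum_univ' y]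
  simp [Fin.sum_univ_two]

/-- The size of the derivatives of `(u, v)` transversal to multiples of the identity. -/
noncomputable def transversalGradient (u v : (Fin 2 → ℝ) → ℝ) (x : Fin 2 → ℝ) : ℝ :=
  |fderiv ℝ u x (Pi.single 1 1)| + |fderiv ℝ v x (Pi.single 0 1)| +
    |fderiv ℝ u x (Pi.single 0 1) - fderiv ℝ v x (Pi.single 1 1)|

theorem continuous_transversalGradient (hu : ContDiff ℝ 1 u) (hv : ContDiff ℝ 1 v) :
    Continuous (transversalGradient u v) := by
  have h1 := hu.continuous_fderiv one_ne_zero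
  have h2 := hv.continuous_fderiv one_ne_zero
  unfold transversalGradient
  fun_prop

theorem transversalGradient_nonneg (u v : (Fin 2 → ℝ) → ℝ) (x : Fin 2 → ℝ) :
    0 ≤ transversalGradient u v x := by
  unfold transversalGradient
  positivity

theorem hasCompactSupport_transversalGradient (huc : HasCompactSupport u)
    (hvc : HasCompactSupport v) : HasCompactSupport (transversalGradient u v) := by
  have hu' := huc.fderiv (𝕜 := ℝ)
  have hv' := hvc.fderiv (𝕜 := ℝ)
  refine HasCompactSupport.intro (hu'.isCompact.union hv'.isCompact) fun x hx => ?_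
  have h1 : fderiv ℝ u x = 0 := image_eq_zero_of_notMem_tsupport fun h => hx (Or.inl h)
  have h2 : fderiv ℝ v x = 0 := image_eq_zero_of_notMem_tsupport fun h => hx (Or.inr h)
  simp [transversalGradient, h1, h2]

theorem abs_integral_moment_le (hρ : Continuous ρ)
    (hρs : ∀ y, y ∉ Metric.closedBall (0 : Fin 2 → ℝ) 1 → ρ y = 0) (hρb : ∀ y, |ρ y| ≤ c)
    (hΘ : LipschitzWith D Θ) (hΘc : HasCompactSupport Θ)
    (hd : ∀ y k, lineDeriv ℝ Θ y (Pi.single k 1) = ρ y * y k)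
    (hu : ContDiff ℝ 1 u) (huc : HasCompactSupport u) (hv : ContDiff ℝ 1 v)
    (hvc : HasCompactSupport v) (x : Fin 2 → ℝ) {s : ℝ} (hs : 0 < s) :
    |∫ y, ρ y * fderiv ℝ u (x - s • y) y| ≤
        c * ∫ y in Metric.closedBall (0 : Fin 2 → ℝ) 1, transversalGradient u v (x - s • y) ∧
      |∫ y, ρ y * fderiv ℝ v (x - s • y) y| ≤
        c * ∫ y in Metric.closedBall (0 : Fin 2 → ℝ) 1, transversalGradient u v (x - s • y) := by
  have hρc : HasCompactSupport ρ := HasCompactSupport.intro (isCompact_closedBall _ _) hρs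
  have hu' := hu.continuous_fderiv one_ne_zero
  have hv' := hv.continuous_fderiv one_ne_zero
  have hH := continuous_transversalGradient hu hv
  have hHi : IntegrableOn (fun y => transversalGradient u v (x - s • y))
      (Metric.closedBall (0 : Fin 2 → ℝ) 1) :=
    ContinuousOn.integrableOn_compact (isCompact_closedBall _ _) (by fun_prop)
  have h_intble : ∀ g : (Fin 2 → ℝ) → ℝ, Continuous g → ∀ k, Integrable fun y => g y * (ρ y * y k) :=
    fun g hg k => Continuous.integrable_of_hasCompactSupport (by fun_prop)
      (hρc.mul_right.mul_left)
  have hc : 0 ≤ c := (abs_nonneg _).trans (hρb 0)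
  have hθ : ∀ y ∈ Metric.closedBall (0 : Fin 2 → ℝ) 1, ∀ k, |ρ y * y k| ≤ c := by
    intro y hy k
    rw [abs_mul]
    have hle : |y k| ≤ 1 := (norm_le_pi_norm y k).trans (mem_closedBall_zero_iff.1 hy)
    simpa using mul_le_mul (hρb y) hle (abs_nonneg _) hc
  have hcu := integral_fderiv_comp_sub_smul_mul_comm hΘ hΘc hd hu huc x hs 0 1
  have hcv := integral_fderiv_comp_sub_smul_mul_comm hΘ hΘc hd hv hvc x hs 1 0
  constructor
  · have e : ∫ y, ρ y * fderiv ℝ u (x - s • y) y =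
        ∫ y, ((fderiv ℝ u (x - s • y) (Pi.single 0 1) - fderiv ℝ v (x - s • y) (Pi.single 1 1)) *
          (ρ y * y 0) + (fderiv ℝ u (x - s • y) (Pi.single 1 1) +
            fderiv ℝ v (x - s • y) (Pi.single 0 1)) * (ρ y * y 1)) := by
      have i1 := h_intble (fun y => fderiv ℝ v (x - s • y) (Pi.single 1 1)) (by fun_prop) 0
      have i2 := h_intble (fun y => fderiv ℝ v (x - s • y) (Pi.single 0 1)) (by fun_prop) 1
      have i3 := h_intble (fun y => fderiv ℝ u (x - s • y) (Pi.single 0 1)) (by fun_prop) 0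
      have i4 := h_intble (fun y => fderiv ℝ u (x - s • y) (Pi.single 1 1)) (by fun_prop) 1
      have : ∀ y, ρ y * fderiv ℝ u (x - s • y) y =
          fderiv ℝ u (x - s • y) (Pi.single 0 1) * (ρ y * y 0) +
            fderiv ℝ u (x - s • y) (Pi.single 1 1) * (ρ y * y 1) := by
        intro y; rw [fderiv_apply_fin_two u _ y]; ring
      simp_rw [this, sub_mul, add_mul]
      have i5 : Integrable fun y => fderiv ℝ u (x - s • y) (Pi.single 0 1) * (ρ y * y 0) -
          fderiv ℝ v (x - s • y) (Pi.single 1 1) * (ρ y * y 0) := i3.sub i1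
      have i6 : Integrable fun y => fderiv ℝ u (x - s • y) (Pi.single 1 1) * (ρ y * y 1) +
          fderiv ℝ v (x - s • y) (Pi.single 0 1) * (ρ y * y 1) := i4.add i2
      rw [integral_add i3 i4, integral_add i5 i6, integral_sub i3 i1,
        integral_add i4 i2, hcv]
      ring
    rw [e]
    refine abs_integral_le_mul_setIntegral measurableSet_closedBall hHi (fun y hy => ?_)
      (fun y hy => by simp [hρs y hy])
    refine (abs_add_le _ _).trans ?_
    rw [abs_mul _ (ρ y * y 0), abs_mul _ (ρ y * y 1)]
    have h0 := hθ y hy 0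
    have h1 := hθ y hy 1
    have h2 := abs_add_le (fderiv ℝ u (x - s • y) (Pi.single 1 1))
      (fderiv ℝ v (x - s • y) (Pi.single 0 1))
    calc _ ≤ |fderiv ℝ u (x - s • y) (Pi.single 0 1) - fderiv ℝ v (x - s • y) (Pi.single 1 1)| * c +
          (|fderiv ℝ u (x - s • y) (Pi.single 1 1)| + |fderiv ℝ v (x - s • y) (Pi.single 0 1)|) * c := by
          gcongr
      _ = _ := by unfold transversalGradient; ring
  · have e : ∫ y, ρ y * fderiv ℝ v (x - s • y) y =
        ∫ y, ((fderiv ℝ u (x - s • y) (Pi.single 1 1) + fderiv ℝ v (x - s • y) (Pi.single 0 1)) *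
          (ρ y * y 0) - (fderiv ℝ u (x - s • y) (Pi.single 0 1) -
            fderiv ℝ v (x - s • y) (Pi.single 1 1)) * (ρ y * y 1)) := by
      have i1 := h_intble (fun y => fderiv ℝ v (x - s • y) (Pi.single 1 1)) (by fun_prop) 1
      have i2 := h_intble (fun y => fderiv ℝ v (x - s • y) (Pi.single 0 1)) (by fun_prop) 0
      have i3 := h_intble (fun y => fderiv ℝ u (x - s • y) (Pi.single 0 1)) (by fun_prop) 1
      have i4 := h_intble (fun y => fderiv ℝ u (x - s • y) (Pi.single 1 1)) (by fun_prop) 0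
      have : ∀ y, ρ y * fderiv ℝ v (x - s • y) y =
          fderiv ℝ v (x - s • y) (Pi.single 0 1) * (ρ y * y 0) +
            fderiv ℝ v (x - s • y) (Pi.single 1 1) * (ρ y * y 1) := by
        intro y; rw [fderiv_apply_fin_two v _ y]; ring
      simp_rw [this, sub_mul, add_mul]
      have i5 : Integrable fun y => fderiv ℝ u (x - s • y) (Pi.single 0 1) * (ρ y * y 1) -
          fderiv ℝ v (x - s • y) (Pi.single 1 1) * (ρ y * y 1) := i3.sub i1
      have i6 : Integrable fun y => fderiv ℝ u (x - s • y) (Pi.single 1 1) * (ρ y * y 0) +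
          fderiv ℝ v (x - s • y) (Pi.single 0 1) * (ρ y * y 0) := i4.add i2
      rw [integral_add i2 i1, integral_sub i6 i5, integral_sub i3 i1,
        integral_add i4 i2, hcu]
      ring
    rw [e]
    refine abs_integral_le_mul_setIntegral measurableSet_closedBall hHi (fun y hy => ?_)
      (fun y hy => by simp [hρs y hy])
    refine (norm_sub_le (E := ℝ) _ _).trans ?_
    simp only [Real.norm_eq_abs]
    rw [abs_mul _ (ρ y * y 0), abs_mul _ (ρ y * y 1)]
    have h0 := hθ y hy 0
    have h1 := hθ y hy 1
    have h2 := abs_add_le (fderiv ℝ u (x - s • y) (Pi.single 1 1))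
      (fderiv ℝ v (x - s • y) (Pi.single 0 1))
    calc _ ≤ (|fderiv ℝ u (x - s • y) (Pi.single 1 1)| + |fderiv ℝ v (x - s • y) (Pi.single 0 1)|) * c +
          |fderiv ℝ u (x - s • y) (Pi.single 0 1) - fderiv ℝ v (x - s • y) (Pi.single 1 1)| * c := by
          gcongr
      _ = _ := by unfold transversalGradient; ring

end Moment

section KeyEstimate

variable {ρ Θ u v r : (Fin 2 → ℝ) → ℝ} {c : ℝ} {D : ℝ≥0}

theorem fderiv_integral_mul_comp_sub_smul_eq_sub (hρ : Continuous ρ) (hρc : HasCompactSupport ρ)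
    (hu : ContDiff ℝ 1 u) (huc : HasCompactSupport u) (hr : LipschitzWith 1 r) {x : Fin 2 → ℝ}
    (hx : DifferentiableAt ℝ r x) (w : Fin 2 → ℝ) :
    fderiv ℝ (fun x => ∫ y, ρ y * u (x - r x • y)) x w =
      (∫ y, ρ y * fderiv ℝ u (x - r x • y) w) -
        fderiv ℝ r x w * ∫ y, ρ y * fderiv ℝ u (x - r x • y) y := by
  have hu' := hu.continuous_fderiv one_ne_zero
  rw [(differentiableAt_integral_mul_comp_sub_smul hρ hρc hu huc hr hx w).2, ← integral_const_mul,
    ← integral_sub]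
  · congr 1; ext y; simp only [map_sub, map_smul, smul_eq_mul]; ring
  · exact Continuous.integrable_of_hasCompactSupport (by fun_prop) hρc.mul_right
  · exact Continuous.integrable_of_hasCompactSupport (by fun_prop) hρc.mul_right.mul_left

theorem fderiv_integral_mul_comp_sub_smul_of_eq_zero (hρ : Continuous ρ)
    (hρc : HasCompactSupport ρ) (hρ1 : ∫ y, ρ y = 1) (hu : ContDiff ℝ 1 u)
    (huc : HasCompactSupport u) (hr : LipschitzWith 1 r) (hr0 : ∀ x, 0 ≤ r x) {x : Fin 2 → ℝ}
    (hx : DifferentiableAt ℝ r x) (h0 : r x = 0) (w : Fin 2 → ℝ) :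
    fderiv ℝ (fun x => ∫ y, ρ y * u (x - r x • y)) x w = fderiv ℝ u x w := by
  have hmin : fderiv ℝ r x = 0 :=
    IsLocalMin.fderiv_eq_zero (Eventually.of_forall fun y => h0.trans_le (hr0 y))
  rw [fderiv_integral_mul_comp_sub_smul_eq_sub hρ hρc hu huc hr hx, hmin, h0]
  simp [integral_mul_const, hρ1]

theorem abs_fderiv_single_le_one (hr : LipschitzWith 1 r) (x : Fin 2 → ℝ) (k : Fin 2) :
    |fderiv ℝ r x (Pi.single k 1)| ≤ 1 := by
  have h := (fderiv ℝ r x).le_of_opNorm_le (norm_fderiv_le_of_lipschitz ℝ hr)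
    (Pi.single k (1 : ℝ))
  simpa [Pi.norm_single] using h

theorem abs_fderiv_fst_le_transversalGradient (u v : (Fin 2 → ℝ) → ℝ) (x : Fin 2 → ℝ) :
    |fderiv ℝ u x (Pi.single 1 1)| ≤ transversalGradient u v x := by
  unfold transversalGradient
  linarith [abs_nonneg (fderiv ℝ v x (Pi.single 0 1)),
    abs_nonneg (fderiv ℝ u x (Pi.single 0 1) - fderiv ℝ v x (Pi.single 1 1))]

theorem abs_fderiv_snd_le_transversalGradient (u v : (Fin 2 → ℝ) → ℝ) (x : Fin 2 → ℝ) :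
    |fderiv ℝ v x (Pi.single 0 1)| ≤ transversalGradient u v x := by
  unfold transversalGradient
  linarith [abs_nonneg (fderiv ℝ u x (Pi.single 1 1)),
    abs_nonneg (fderiv ℝ u x (Pi.single 0 1) - fderiv ℝ v x (Pi.single 1 1))]

theorem abs_fderiv_sub_le_transversalGradient (u v : (Fin 2 → ℝ) → ℝ) (x : Fin 2 → ℝ) :
    |fderiv ℝ u x (Pi.single 0 1) - fderiv ℝ v x (Pi.single 1 1)| ≤
      transversalGradient u v x := by
  unfold transversalGradient
  linarith [abs_nonneg (fderiv ℝ u x (Pi.single 1 1)), abs_nonneg (fderiv ℝ v x (Pi.single 0 1))]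

theorem abs_integral_mul_comp_le {g H : (Fin 2 → ℝ) → ℝ} (hH : Continuous H)
    (hρs : ∀ y, y ∉ Metric.closedBall (0 : Fin 2 → ℝ) 1 → ρ y = 0) (hρb : ∀ y, |ρ y| ≤ c)
    (hg : ∀ y, |g y| ≤ H y) (x : Fin 2 → ℝ) (s : ℝ) :
    |∫ y, ρ y * g (x - s • y)| ≤
      c * ∫ y in Metric.closedBall (0 : Fin 2 → ℝ) 1, H (x - s • y) := by
  refine abs_integral_le_mul_setIntegral measurableSet_closedBall
    (ContinuousOn.integrableOn_compact (isCompact_closedBall _ _) (by fun_prop))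
    (fun y _ => ?_) fun y hy => by simp [hρs y hy]
  rw [abs_mul]
  exact mul_le_mul (hρb y) (hg _) (abs_nonneg _) ((abs_nonneg _).trans (hρb 0))

theorem sq_transversal_integral_le (hρ : Continuous ρ)
    (hρs : ∀ y, y ∉ Metric.closedBall (0 : Fin 2 → ℝ) 1 → ρ y = 0) (hρb : ∀ y, |ρ y| ≤ c)
    (hρ1 : ∫ y, ρ y = 1) (hΘ : LipschitzWith D Θ) (hΘc : HasCompactSupport Θ)
    (hd : ∀ y k, lineDeriv ℝ Θ y (Pi.single k 1) = ρ y * y k)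
    (hu : ContDiff ℝ 1 u) (huc : HasCompactSupport u) (hv : ContDiff ℝ 1 v)
    (hvc : HasCompactSupport v) (hr : LipschitzWith 1 r) (hr0 : ∀ x, 0 ≤ r x) {x : Fin 2 → ℝ}
    (hN : ∫ y in Metric.closedBall (0 : Fin 2 → ℝ) 1, transversalGradient u v (x - r x • y) ≤ 1)
    (hx : DifferentiableAt ℝ r x) :
    fderiv ℝ (fun x => ∫ y, ρ y * u (x - r x • y)) x (Pi.single 1 1) ^ 2 +
        fderiv ℝ (fun x => ∫ y, ρ y * v (x - r x • y)) x (Pi.single 0 1) ^ 2 +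
        (fderiv ℝ (fun x => ∫ y, ρ y * u (x - r x • y)) x (Pi.single 0 1) -
          fderiv ℝ (fun x => ∫ y, ρ y * v (x - r x • y)) x (Pi.single 1 1)) ^ 2 ≤
      17 * c ^ 2 * indicator {x | 0 < r x} 1 x + transversalGradient u v x := by
  have hρc : HasCompactSupport ρ := HasCompactSupport.intro (isCompact_closedBall _ _) hρs
  have hc : 0 ≤ c := (abs_nonneg _).trans (hρb 0)
  have hH := continuous_transversalGradient hu hv
  have hu' := hu.continuous_fderiv one_ne_zero
  have hv' := hv.continuous_fderiv one_ne_zero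
  have hHx := transversalGradient_nonneg u v x
  rcases (hr0 x).eq_or_lt with h0 | hpos
  · simp only [fderiv_integral_mul_comp_sub_smul_of_eq_zero hρ hρc hρ1 hu huc hr hr0 hx h0.symm,
      fderiv_integral_mul_comp_sub_smul_of_eq_zero hρ hρc hρ1 hv hvc hr hr0 hx h0.symm]
    have hvol : (volume : Measure (Fin 2 → ℝ)).real (Metric.closedBall 0 1) = 4 := by
      rw [Measure.real, Real.volume_pi_closedBall _ zero_le_one]
      norm_num
    rw [← h0] at hN
    simp only [zero_smul, sub_zero, setIntegral_const, hvol, smul_eq_mul] at hN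
    have hind : indicator {x | 0 < r x} (1 : (Fin 2 → ℝ) → ℝ) x = 0 :=
      indicator_of_notMem (by simp [← h0]) _
    rw [hind, mul_zero, zero_add]
    refine le_trans ?_ (by nlinarith : transversalGradient u v x ^ 2 ≤ transversalGradient u v x)
    unfold transversalGradient
    rw [← sq_abs, ← sq_abs (fderiv ℝ v x (Pi.single 0 1)),
      ← sq_abs (fderiv ℝ u x (Pi.single 0 1) - _)]
    generalize fderiv ℝ u x (Pi.single 0 1) - fderiv ℝ v x (Pi.single 1 1) = d
    nlinarith [abs_nonneg (fderiv ℝ u x (Pi.single 1 1)), abs_nonneg d,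
      abs_nonneg (fderiv ℝ v x (Pi.single 0 1)), mul_nonneg (abs_nonneg (fderiv ℝ u x (Pi.single 1 1))) (abs_nonneg d), mul_nonneg (abs_nonneg (fderiv ℝ v x (Pi.single 0 1))) (abs_nonneg d),
      mul_nonneg (abs_nonneg (fderiv ℝ u x (Pi.single 1 1))) (abs_nonneg (fderiv ℝ v x (Pi.single 0 1)))]
  · obtain ⟨hEu, hEv⟩ := abs_integral_moment_le hρ hρs hρb hΘ hΘc hd hu huc hv hvc x hpos
    have hcN := mul_le_of_le_one_right hc hN
    have hind : indicator {x | 0 < r x} (1 : (Fin 2 → ℝ) → ℝ) x = 1 :=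
      indicator_of_mem (s := {x | 0 < r x}) hpos _
    have ha := abs_integral_mul_comp_le hH hρs hρb
      (abs_fderiv_fst_le_transversalGradient u v) x (r x)
    have hb := abs_integral_mul_comp_le hH hρs hρb
      (abs_fderiv_snd_le_transversalGradient u v) x (r x)
    have hdd := abs_integral_mul_comp_le hH hρs hρb
      (abs_fderiv_sub_le_transversalGradient u v) x (r x)
    have hsub : ∫ y, ρ y * (fderiv ℝ u (x - r x • y) (Pi.single 0 1) -
        fderiv ℝ v (x - r x • y) (Pi.single 1 1)) =
        (∫ y, ρ y * fderiv ℝ u (x - r x • y) (Pi.single 0 1)) -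
          ∫ y, ρ y * fderiv ℝ v (x - r x • y) (Pi.single 1 1) := by
      simp_rw [mul_sub]
      exact integral_sub
        (Continuous.integrable_of_hasCompactSupport (by fun_prop) hρc.mul_right)
        (Continuous.integrable_of_hasCompactSupport (by fun_prop) hρc.mul_right)
    simp only [hsub] at hdd
    simp only [fderiv_integral_mul_comp_sub_smul_eq_sub hρ hρc hu huc hr hx,
      fderiv_integral_mul_comp_sub_smul_eq_sub hρ hρc hv hvc hr hx, hind]
    have hr_0 := abs_fderiv_single_le_one hr x 0
    have hr_1 := abs_fderiv_single_le_one hr x 1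
    generalize (∫ y, ρ y * fderiv ℝ u (x - r x • y) y) = Eu at *
    generalize (∫ y, ρ y * fderiv ℝ v (x - r x • y) y) = Ev at *
    generalize fderiv ℝ r x (Pi.single 0 1) = d0 at *
    generalize fderiv ℝ r x (Pi.single 1 1) = d1 at *
    have hprod : ∀ d E : ℝ, |d| ≤ 1 → |E| ≤ c → |d * E| ≤ c := fun d E h1 h2 => by
      rw [abs_mul]; nlinarith [abs_nonneg d, abs_nonneg E]
    have p1 := abs_le.1 (hprod _ _ hr_1 (hEu.trans hcN))
    have p2 := abs_le.1 (hprod _ _ hr_0 (hEv.trans hcN))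
    have p3 := abs_le.1 (hprod _ _ hr_0 (hEu.trans hcN))
    have p4 := abs_le.1 (hprod _ _ hr_1 (hEv.trans hcN))
    have q1 := abs_le.1 (ha.trans hcN)
    have q2 := abs_le.1 (hb.trans hcN)
    have q3 := abs_le.1 (hdd.trans hcN)
    have sq : ∀ t M : ℝ, -M ≤ t → t ≤ M → t ^ 2 ≤ M ^ 2 := fun t M h1 h2 => sq_le_sq' h1 h2
    refine le_trans (add_le_add_three (sq _ (2 * c) ?_ ?_) (sq _ (2 * c) ?_ ?_)
      (sq _ (3 * c) ?_ ?_)) (by nlinarith) <;> linarith [p1.1, p1.2, p2.1, p2.2, p3.1, p3.2, p4.1, p4.2, q1.1, q1.2, q2.1, q2.2, q3.1, q3.2]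

end KeyEstimate

theorem exists_integral_min_one_sq_fderiv_le : ∃ C : ℝ, 0 ≤ C ∧ ∀ u v : (Fin 2 → ℝ) → ℝ,
    ContDiff ℝ 1 u → ContDiff ℝ 1 v → HasCompactSupport u → HasCompactSupport v →
      ∫ x, min 1 (fderiv ℝ u x (Pi.single 0 1) ^ 2) ≤ C * ∫ x, transversalGradient u v x := by
  obtain ⟨ρ, Θ, c, D, hρ, hρs, hρb, hρ1, hΘ, hΘc, hd⟩ := exists_radial_kernel
  refine ⟨64 + 64 * (17 * c ^ 2) + 1, by positivity, fun u v hu hv huc hvc => ?_⟩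
  have hρc : HasCompactSupport ρ := HasCompactSupport.intro (isCompact_closedBall _ _) hρs
  have hH := continuous_transversalGradient hu hv
  have hHi : Integrable (transversalGradient u v) :=
    hH.integrable_of_hasCompactSupport (hasCompactSupport_transversalGradient huc hvc)
  have hH0 := transversalGradient_nonneg u v
  obtain ⟨r, hr, hr0, ⟨S, hrS⟩, hN, hvol⟩ := exists_lipschitz_averaging_radius hH hH0 hHi
  obtain ⟨Lu, hLu⟩ := hu.lipschitzWith_of_hasCompactSupport huc one_ne_zero
  obtain ⟨Lv, hLv⟩ := hv.lipschitzWith_of_hasCompactSupport hvc one_ne_zero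
  obtain ⟨Ku, hKu⟩ := lipschitzWith_integral_mul_comp_sub_smul hρ hρc hLu hr
  obtain ⟨Kv, hKv⟩ := lipschitzWith_integral_mul_comp_sub_smul hρ hρc hLv hr
  have hcu := hasCompactSupport_integral_mul_comp_sub_smul hρs huc hr0 hrS
  have hcv := hasCompactSupport_integral_mul_comp_sub_smul hρs hvc hr0 hrS
  have hdu : ∀ x, DifferentiableAt ℝ r x → DifferentiableAt ℝ _ x := fun x hx =>
    (differentiableAt_integral_mul_comp_sub_smul hρ hρc hu huc hr hx 0).1
  have hdv : ∀ x, DifferentiableAt ℝ r x → DifferentiableAt ℝ _ x := fun x hx =>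
    (differentiableAt_integral_mul_comp_sub_smul hρ hρc hv hvc hr hx 0).1
  have hmain := fun x => sq_transversal_integral_le hρ hρs hρb hρ1 hΘ hΘc hd hu huc hv hvc hr hr0
    (hN x)
  have hzero := fun x => fderiv_integral_mul_comp_sub_smul_of_eq_zero hρ hρc hρ1 hu huc hr hr0
    (x := x)
  generalize (fun x => ∫ y, ρ y * u (x - r x • y)) = U at *
  generalize (fun x => ∫ y, ρ y * v (x - r x • y)) = V at *
  have hdet := hKu.integral_lineDeriv_mul_lineDeriv_comm (μ := volume) hKv hcu hcv
    (Pi.single 0 1) (Pi.single 1 1)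
  have hmul : ∀ {f g : (Fin 2 → ℝ) → ℝ} {K M : ℝ≥0}, LipschitzWith K f → LipschitzWith M g →
      HasCompactSupport f → ∀ a b, Integrable fun x => lineDeriv ℝ f x a * lineDeriv ℝ g x b := by
    intro f g K M hf hg hfc a b
    refine (hf.integrable_lineDeriv hfc a).mul_bdd (c := M * ‖b‖)
      (aestronglyMeasurable_lineDeriv hg.continuous _)
      (.of_forall fun x => norm_lineDeriv_le_of_lipschitz ℝ hg)
  set e0 : Fin 2 → ℝ := Pi.single 0 1
  set e1 : Fin 2 → ℝ := Pi.single 1 1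
  set Ω : Set (Fin 2 → ℝ) := {x | 0 < r x}
  have hΩ : MeasurableSet Ω := (isOpen_lt continuous_const hr.continuous).measurableSet
  have hΩr : volume.real Ω ≤ 64 * ∫ x, transversalGradient u v x :=
    ENNReal.toReal_le_of_le_ofReal
      (mul_nonneg (by norm_num) (integral_nonneg hH0)) hvol
  have hΩi : Integrable (indicator Ω (1 : (Fin 2 → ℝ) → ℝ)) :=
    (integrable_indicator_iff hΩ).2
      (integrableOn_const (hvol.trans_lt ENNReal.ofReal_lt_top).ne)
  have hae : ∀ᵐ x, DifferentiableAt ℝ r x := hr.ae_differentiableAt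
  have hdet0 : ∫ x, (lineDeriv ℝ U x e0 * lineDeriv ℝ V x e1 -
      lineDeriv ℝ U x e1 * lineDeriv ℝ V x e0) = 0 := by
    rw [integral_sub (hmul hKu hKv hcu _ _) (hmul hKu hKv hcu _ _), hdet, sub_self]
  have hsq : ∀ x, DifferentiableAt ℝ r x → lineDeriv ℝ U x e0 * lineDeriv ℝ U x e0 ≤
      (17 * c ^ 2 * indicator Ω 1 x + transversalGradient u v x) +
        2 * (lineDeriv ℝ U x e0 * lineDeriv ℝ V x e1 -
          lineDeriv ℝ U x e1 * lineDeriv ℝ V x e0) := by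
    intro x hx
    have h := hmain x hx
    rw [(hdu x hx).lineDeriv_eq_fderiv, (hdu x hx).lineDeriv_eq_fderiv,
      (hdv x hx).lineDeriv_eq_fderiv, (hdv x hx).lineDeriv_eq_fderiv]
    nlinarith [sq_nonneg (fderiv ℝ U x e1 - fderiv ℝ V x e0), sq_nonneg (fderiv ℝ V x e1)]
  have hI1 : Integrable fun x => 17 * c ^ 2 * indicator Ω (1 : (Fin 2 → ℝ) → ℝ) x :=
    hΩi.const_mul _
  have hI2 : Integrable fun x =>
      17 * c ^ 2 * indicator Ω (1 : (Fin 2 → ℝ) → ℝ) x + transversalGradient u v x :=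
    hI1.add hHi
  have hI3 : Integrable fun x => 2 * (lineDeriv ℝ U x e0 * lineDeriv ℝ V x e1 -
      lineDeriv ℝ U x e1 * lineDeriv ℝ V x e0) :=
    ((hmul hKu hKv hcu _ _).sub (hmul hKu hKv hcu _ _)).const_mul 2
  have hind : ∫ x, indicator Ω (1 : (Fin 2 → ℝ) → ℝ) x = volume.real Ω := integral_indicator_one hΩ
  have hp : ∫ x, lineDeriv ℝ U x e0 * lineDeriv ℝ U x e0 ≤
      17 * c ^ 2 * volume.real Ω + ∫ x, transversalGradient u v x := by
    refine (integral_mono_ae (hmul hKu hKu hcu _ _) (hI2.add hI3)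
      (hae.mono fun x hx => hsq x hx)).trans_eq ?_
    simp only [Pi.add_apply]
    rw [integral_add hI2 hI3, integral_add hI1 hHi, integral_const_mul, integral_const_mul,
      hdet0, hind]
    ring
  have hfin : ∫ x, min 1 (fderiv ℝ u x e0 ^ 2) ≤
      volume.real Ω + ∫ x, lineDeriv ℝ U x e0 * lineDeriv ℝ U x e0 := by
    rw [← hind, ← integral_add hΩi (hmul hKu hKu hcu _ _)]
    refine integral_mono_of_nonneg (.of_forall fun x => by positivity)
      (hΩi.add (hmul hKu hKu hcu _ _)) ?_
    filter_upwards [hae] with x hx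
    by_cases h : 0 < r x
    · rw [indicator_of_mem (s := Ω) h]
      exact (min_le_left _ _).trans (le_add_of_nonneg_right (mul_self_nonneg _))
    · rw [indicator_of_notMem (s := Ω) h, zero_add, (hdu x hx).lineDeriv_eq_fderiv,
        hzero x hx (le_antisymm (not_lt.1 h) (hr0 x)), ← sq]
      exact min_le_right _ _
  have h_int_nonneg : 0 ≤ ∫ x, transversalGradient u v x := integral_nonneg hH0
  nlinarith [mul_le_mul_of_nonneg_left hΩr (by positivity : 0 ≤ 17 * c ^ 2)]

section Envelope

variable {m n : ℕ} {G : Matrix (Fin m) (Fin n) ℝ → ℝ} {L : ℝ}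

/-- The sum of the absolute values of the entries of a matrix. -/
def entrySum (z : Matrix (Fin m) (Fin n) ℝ) : ℝ := ∑ i, ∑ j, |z i j|

theorem continuous_entrySum : Continuous (entrySum : Matrix (Fin m) (Fin n) ℝ → ℝ) := by
  unfold entrySum
  fun_prop

theorem continuous_of_abs_sub_le_entrySum (hG : ∀ z w, |G z - G w| ≤ L * entrySum (z - w)) :
    Continuous G := by
  refine continuous_iff_continuousAt.2 fun w => ?_
  rw [ContinuousAt, tendsto_iff_dist_tendsto_zero]
  have h : Tendsto (fun z => L * entrySum (z - w)) (𝓝 w) (𝓝 0) := by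
    have hc : Continuous fun z => L * entrySum (z - w) :=
      continuous_const.mul (continuous_entrySum.comp (continuous_id.sub continuous_const))
    simpa [entrySum] using hc.tendsto w
  exact squeeze_zero (fun _ => dist_nonneg) (fun z => hG z w) h

theorem continuous_jacobianMatrix {φ : (Fin n → ℝ) → (Fin m → ℝ)} (hφ : ContDiff ℝ 1 φ) :
    Continuous (jacobianMatrix φ) := by
  have h := hφ.continuous_fderiv one_ne_zero
  unfold jacobianMatrix
  refine continuous_matrix fun i j => ?_
  simp only [Matrix.of_apply]
  fun_prop

theorem volume_unitCube (n : ℕ) : volume (unitCube n) = 1 := by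
  simp [unitCube, Real.volume_pi_Ioo]

theorem unitCube_subset_Icc (n : ℕ) : unitCube n ⊆ Icc 0 1 := fun _ hx =>
  ⟨fun i => (hx i (mem_univ i)).1.le, fun i => (hx i (mem_univ i)).2.le⟩

theorem Continuous.integrableOn_unitCube {g : (Fin n → ℝ) → ℝ} (hg : Continuous g) :
    IntegrableOn g (unitCube n) :=
  (hg.continuousOn.integrableOn_compact isCompact_Icc).mono_set (unitCube_subset_Icc n)

theorem setIntegral_unitCube_const (n : ℕ) (c : ℝ) : ∫ _ in unitCube n, c = c := by
  simp [Measure.real, volume_unitCube]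

/-- Smooth maps compactly supported in the open unit cube. -/
def cubeTestMaps (m n : ℕ) : Set ((Fin n → ℝ) → (Fin m → ℝ)) :=
  {φ | ContDiff ℝ (⊤ : ℕ∞) φ ∧ HasCompactSupport φ ∧ tsupport φ ⊆ unitCube n}

theorem zero_mem_cubeTestMaps : (0 : (Fin n → ℝ) → (Fin m → ℝ)) ∈ cubeTestMaps m n :=
  ⟨contDiff_const, HasCompactSupport.zero, by simp [tsupport]⟩

instance : Nonempty (cubeTestMaps m n) := ⟨⟨0, zero_mem_cubeTestMaps⟩⟩

theorem jacobianMatrix_zero (x : Fin n → ℝ) :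
    jacobianMatrix (0 : (Fin n → ℝ) → (Fin m → ℝ)) x = 0 := by
  ext i j
  simp [jacobianMatrix]

/-- The quasiconvex envelope given by Dacorogna's formula. -/
noncomputable def quasiconvexEnvelope (G : Matrix (Fin m) (Fin n) ℝ → ℝ)
    (z : Matrix (Fin m) (Fin n) ℝ) : ℝ :=
  ⨅ φ : cubeTestMaps m n, ∫ x in unitCube n, G (z + jacobianMatrix φ x)

theorem quasiconvexEnvelope_le_integral (h0 : ∀ z, 0 ≤ G z) (z : Matrix (Fin m) (Fin n) ℝ)
    {φ : (Fin n → ℝ) → (Fin m → ℝ)} (hφ : φ ∈ cubeTestMaps m n) :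
    quasiconvexEnvelope G z ≤ ∫ x in unitCube n, G (z + jacobianMatrix φ x) := by
  have hb : BddBelow (range fun φ : cubeTestMaps m n =>
      ∫ x in unitCube n, G (z + jacobianMatrix φ x)) :=
    ⟨0, forall_mem_range.2 fun φ => integral_nonneg fun x => h0 _⟩
  exact ciInf_le hb ⟨φ, hφ⟩

theorem quasiconvexEnvelope_nonneg (h0 : ∀ z, 0 ≤ G z) (z : Matrix (Fin m) (Fin n) ℝ) :
    0 ≤ quasiconvexEnvelope G z :=
  le_ciInf fun _ => integral_nonneg fun _ => h0 _

theorem quasiconvexEnvelope_le (h0 : ∀ z, 0 ≤ G z) (z : Matrix (Fin m) (Fin n) ℝ) :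
    quasiconvexEnvelope G z ≤ G z := by
  refine (quasiconvexEnvelope_le_integral h0 z zero_mem_cubeTestMaps).trans_eq ?_
  simp [jacobianMatrix_zero, Measure.real, volume_unitCube]

theorem continuous_comp_add_jacobianMatrix (hG : ∀ z w, |G z - G w| ≤ L * entrySum (z - w))
    {φ : (Fin n → ℝ) → (Fin m → ℝ)} (hφ : φ ∈ cubeTestMaps m n) (z : Matrix (Fin m) (Fin n) ℝ) :
    Continuous fun x => G (z + jacobianMatrix φ x) :=
  (continuous_of_abs_sub_le_entrySum hG).comp (continuous_const.add
    (continuous_jacobianMatrix (hφ.1.of_le (by exact_mod_cast le_top))))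

theorem abs_quasiconvexEnvelope_sub_le (h0 : ∀ z, 0 ≤ G z)
    (hG : ∀ z w, |G z - G w| ≤ L * entrySum (z - w)) (z w : Matrix (Fin m) (Fin n) ℝ) :
    |quasiconvexEnvelope G z - quasiconvexEnvelope G w| ≤ L * entrySum (z - w) := by
  have key : ∀ z w : Matrix (Fin m) (Fin n) ℝ,
      quasiconvexEnvelope G z - L * entrySum (z - w) ≤ quasiconvexEnvelope G w := by
    refine fun z w => le_ciInf fun φ => ?_
    have hz := (continuous_comp_add_jacobianMatrix hG φ.2 z).integrableOn_unitCube
    have hw := (continuous_comp_add_jacobianMatrix hG φ.2 w).integrableOn_unitCube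
    have hle : ∫ x in unitCube n, G (z + jacobianMatrix φ x) ≤
        ∫ x in unitCube n, (G (w + jacobianMatrix φ x) + L * entrySum (z - w)) := by
      refine integral_mono hz (hw.add continuous_const.integrableOn_unitCube) fun x => ?_
      have h := (abs_le.1 (hG (z + jacobianMatrix φ x) (w + jacobianMatrix φ x))).2
      rw [add_sub_add_right_eq_sub] at h
      linarith
    rw [integral_add hw continuous_const.integrableOn_unitCube,
      setIntegral_unitCube_const] at hle
    linarith [quasiconvexEnvelope_le_integral h0 z φ.2]
  have hsymm : entrySum (w - z) = entrySum (z - w) := by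
    simp [entrySum, abs_sub_comm]
  have h1 := key z w
  have h2 := key w z
  rw [hsymm] at h2
  exact abs_le.2 ⟨by linarith, by linarith⟩

end Envelope

section Quasiconvex

variable {m n : ℕ} {G : Matrix (Fin m) (Fin n) ℝ → ℝ} {L : ℝ}

theorem jacobianMatrix_eq_zero {φ : (Fin n → ℝ) → (Fin m → ℝ)} {x : Fin n → ℝ}
    (hx : x ∉ tsupport φ) : jacobianMatrix φ x = 0 := by
  have h : fderiv ℝ φ x = 0 :=
    image_eq_zero_of_notMem_tsupport fun h => hx (tsupport_fderiv_subset ℝ h)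
  ext i j
  simp [jacobianMatrix, h]

/-- The half-open unit cube. -/
def halfOpenCube (n : ℕ) : Set (Fin n → ℝ) := univ.pi fun _ => Ico (0 : ℝ) 1

theorem mem_halfOpenCube {x : Fin n → ℝ} : x ∈ halfOpenCube n ↔ ∀ i, 0 ≤ x i ∧ x i < 1 := by
  simp [halfOpenCube, Set.mem_pi]

theorem measurableSet_halfOpenCube (n : ℕ) : MeasurableSet (halfOpenCube n) :=
  MeasurableSet.univ_pi fun _ => measurableSet_Ico

theorem halfOpenCube_subset_Icc (n : ℕ) : halfOpenCube n ⊆ Icc 0 1 := fun _ hx =>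
  ⟨fun i => (hx i (mem_univ i)).1, fun i => (hx i (mem_univ i)).2.le⟩

theorem unitCube_ae_eq_halfOpenCube (n : ℕ) : unitCube n =ᵐ[volume] halfOpenCube n :=
  (Measure.univ_pi_Ioo_ae_eq_Icc (μ := fun _ => (volume : Measure ℝ)) (f := fun _ : Fin n => (0 : ℝ))
    (g := fun _ => (1 : ℝ))).trans Measure.univ_pi_Ico_ae_eq_Icc.symm

/-- The cell with corner `k / N` of the partition of the half-open unit cube into `N ^ n`
translates of its rescaling. -/
def subcube (N : ℕ) (k : Fin n → Fin N) : Set (Fin n → ℝ) :=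
  (fun x => (N : ℝ) • x - fun i => ((k i : ℕ) : ℝ)) ⁻¹' halfOpenCube n

theorem mem_subcube {N : ℕ} {k : Fin n → Fin N} {x : Fin n → ℝ} :
    x ∈ subcube N k ↔ ∀ i, (k i : ℝ) ≤ N * x i ∧ N * x i < k i + 1 := by
  simp [subcube, mem_halfOpenCube, sub_lt_iff_lt_add']

theorem measurableSet_subcube (N : ℕ) (k : Fin n → Fin N) : MeasurableSet (subcube N k) :=
  (by fun_prop : Measurable fun x : Fin n → ℝ => (N : ℝ) • x - fun i => ((k i : ℕ) : ℝ))
    (measurableSet_halfOpenCube n)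

theorem eq_of_mem_subcube {N : ℕ} {k l : Fin n → Fin N} {x : Fin n → ℝ} (hk : x ∈ subcube N k)
    (hl : ∀ i, (l i : ℝ) ≤ N * x i ∧ N * x i < l i + 1) : k = l := by
  rw [mem_subcube] at hk
  ext i
  have h1 : ((k i : ℕ) : ℝ) < (l i : ℕ) + 1 := (hk i).1.trans_lt (hl i).2
  have h2 : ((l i : ℕ) : ℝ) < (k i : ℕ) + 1 := (hl i).1.trans_lt (hk i).2
  norm_cast at h1 h2
  omega

theorem iUnion_subcube {N : ℕ} (hN : 0 < N) :
    ⋃ k : Fin n → Fin N, subcube N k = halfOpenCube n := by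
  have hN' : (0 : ℝ) < N := by exact_mod_cast hN
  ext x
  simp only [mem_iUnion, mem_subcube, mem_halfOpenCube]
  constructor
  · rintro ⟨k, hk⟩ i
    have h1 : ((k i : ℕ) : ℝ) + 1 ≤ N := by exact_mod_cast (k i).2
    have h0 : (0 : ℝ) ≤ (k i : ℕ) := Nat.cast_nonneg _
    exact ⟨nonneg_of_mul_nonneg_right (h0.trans (hk i).1) hN',
      lt_of_mul_lt_mul_left (by linarith [(hk i).2]) hN'.le⟩
  · intro hx
    refine ⟨fun i => ⟨⌊N * x i⌋₊, ?_⟩, fun i => ⟨?_, ?_⟩⟩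
    · rw [Nat.floor_lt (by have := (hx i).1; positivity)]
      nlinarith [(hx i).2]
    · exact Nat.floor_le (by have := (hx i).1; positivity)
    · exact Nat.lt_floor_add_one _

theorem setIntegral_subcube_comp {N : ℕ} (hN : 0 < N) (k : Fin n → Fin N) (h : (Fin n → ℝ) → ℝ) :
    ∫ x in subcube N k, h ((N : ℝ) • x - fun i => ((k i : ℕ) : ℝ)) =
      ((N : ℝ) ^ n)⁻¹ * ∫ x in unitCube n, h x := by
  rw [setIntegral_congr_set (unitCube_ae_eq_halfOpenCube n),
    ← integral_indicator (measurableSet_subcube N k),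
    ← integral_indicator (measurableSet_halfOpenCube n)]
  have h1 := Measure.integral_comp_smul (volume : Measure (Fin n → ℝ))
    (fun x => (halfOpenCube n).indicator h (x - fun i => ((k i : ℕ) : ℝ))) (N : ℝ)
  rw [integral_sub_right_eq_self (fun x => (halfOpenCube n).indicator h x), Module.finrank_fin_fun,
    smul_eq_mul, abs_of_nonneg (by positivity)] at h1
  exact h1

theorem superposition_mem_cubeTestMaps {N : ℕ} (hN : 0 < N) {ψ : (Fin n → ℝ) → (Fin m → ℝ)}
    (hψ : ψ ∈ cubeTestMaps m n) {φ : (Fin n → Fin N) → (Fin n → ℝ) → (Fin m → ℝ)}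
    (hφ : ∀ k, φ k ∈ cubeTestMaps m n) :
    (fun x => ψ x + ∑ k, (N : ℝ)⁻¹ • φ k ((N : ℝ) • x - fun i => ((k i : ℕ) : ℝ))) ∈
      cubeTestMaps m n := by
  have hN' : (0 : ℝ) < N := by exact_mod_cast hN
  set Φ := fun x => ψ x + ∑ k, (N : ℝ)⁻¹ • φ k ((N : ℝ) • x - fun i => ((k i : ℕ) : ℝ))
  set K : Set (Fin n → ℝ) := tsupport ψ ∪
    ⋃ k : Fin n → Fin N, (fun y => (N : ℝ)⁻¹ • (y + fun i => ((k i : ℕ) : ℝ))) '' tsupport (φ k)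
  have hK : IsCompact K := hψ.2.1.isCompact.union
    (isCompact_iUnion fun k => (hφ k).2.1.isCompact.image (by fun_prop))
  have hKsub : K ⊆ unitCube n := by
    refine union_subset hψ.2.2 (iUnion_subset fun k => ?_)
    rintro _ ⟨y, hy, rfl⟩ i -
    have hyi := (hφ k).2.2 hy i (mem_univ i)
    have h1 : ((k i : ℕ) : ℝ) + 1 ≤ N := by exact_mod_cast (k i).2
    have h0 : (0 : ℝ) ≤ (k i : ℕ) := Nat.cast_nonneg _
    simp only [Pi.smul_apply, Pi.add_apply, smul_eq_mul, inv_mul_eq_div]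
    exact ⟨div_pos (by linarith [hyi.1]) hN', (div_lt_one hN').2 (by linarith [hyi.2])⟩
  have hzero : ∀ x ∉ K, Φ x = 0 := by
    intro x hx
    have h1 : ψ x = 0 := image_eq_zero_of_notMem_tsupport fun h => hx (Or.inl h)
    have h2 : ∀ k, φ k ((N : ℝ) • x - fun i => ((k i : ℕ) : ℝ)) = 0 := fun k =>
      image_eq_zero_of_notMem_tsupport fun h => hx (Or.inr (mem_iUnion.2 ⟨k, _, h, by
        simp [smul_smul, inv_mul_cancel₀ hN'.ne']⟩))
    simp [Φ, h1, h2]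
  refine ⟨?_, HasCompactSupport.intro hK hzero, (closure_minimal ?_ hK.isClosed).trans hKsub⟩
  · have := hψ.1
    have := fun k => (hφ k).1
    fun_prop
  · intro x hx
    by_contra h
    exact hx (hzero x h)

theorem jacobianMatrix_superposition {N : ℕ} (hN : 0 < N) {ψ : (Fin n → ℝ) → (Fin m → ℝ)}
    (hψ : Differentiable ℝ ψ) {φ : (Fin n → Fin N) → (Fin n → ℝ) → (Fin m → ℝ)}
    (hφ : ∀ k, Differentiable ℝ (φ k)) (x : Fin n → ℝ) :
    jacobianMatrix
        (fun x => ψ x + ∑ k, (N : ℝ)⁻¹ • φ k ((N : ℝ) • x - fun i => ((k i : ℕ) : ℝ))) x =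
      jacobianMatrix ψ x +
        ∑ k, jacobianMatrix (φ k) ((N : ℝ) • x - fun i => ((k i : ℕ) : ℝ)) := by
  have hN' : (N : ℝ) ≠ 0 := by exact_mod_cast hN.ne'
  have h1 : ∀ k : Fin n → Fin N, HasFDerivAt
      (fun x => (N : ℝ)⁻¹ • φ k ((N : ℝ) • x - fun i => ((k i : ℕ) : ℝ)))
      (fderiv ℝ (φ k) ((N : ℝ) • x - fun i => ((k i : ℕ) : ℝ))) x := by
    intro k
    have h2 : HasFDerivAt (fun x : Fin n → ℝ => (N : ℝ) • x - fun i => ((k i : ℕ) : ℝ))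
        ((N : ℝ) • ContinuousLinearMap.id ℝ (Fin n → ℝ)) x :=
      ((hasFDerivAt_id x).const_smul (N : ℝ)).sub_const _
    have h3 := ((hφ k _).hasFDerivAt.comp x h2).const_smul (N : ℝ)⁻¹
    refine h3.congr_fderiv ?_
    ext y
    simp [hN']
  have h4 : HasFDerivAt (fun x => ψ x + ∑ k, (N : ℝ)⁻¹ • φ k ((N : ℝ) • x - fun i => ((k i : ℕ) : ℝ)))
      _ x := (hψ x).hasFDerivAt.add (HasFDerivAt.fun_sum fun k _ => h1 k)
  ext i j
  simp [jacobianMatrix, h4.fderiv, Matrix.sum_apply]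

theorem exists_entrySum_jacobianMatrix_sub_le {ψ : (Fin n → ℝ) → (Fin m → ℝ)}
    (hψ : ψ ∈ cubeTestMaps m n) {η : ℝ} (hη : 0 < η) : ∃ δ > 0, ∀ x y, dist x y < δ →
      entrySum (jacobianMatrix ψ x - jacobianMatrix ψ y) ≤ η := by
  have hu : UniformContinuous (fderiv ℝ ψ) :=
    (hψ.2.1.fderiv (𝕜 := ℝ)).uniformContinuous_of_continuous
      (hψ.1.continuous_fderiv (by simp))
  obtain ⟨δ, hδ, h⟩ := Metric.uniformContinuous_iff.1 hu (η / (m * n + 1)) (by positivity)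
  refine ⟨δ, hδ, fun x y hxy => ?_⟩
  have hent : ∀ i j, |(jacobianMatrix ψ x - jacobianMatrix ψ y) i j| ≤ η / (m * n + 1) := by
    intro i j
    have h1 := (fderiv ℝ ψ x - fderiv ℝ ψ y).le_of_opNorm_le
      ((dist_eq_norm (fderiv ℝ ψ x) (fderiv ℝ ψ y)) ▸ (h hxy).le) (Pi.single j (1 : ℝ))
    rw [Pi.norm_single, norm_one, mul_one] at h1
    exact (norm_le_pi_norm _ i).trans h1
  calc entrySum (jacobianMatrix ψ x - jacobianMatrix ψ y)
      ≤ ∑ _i : Fin m, ∑ _j : Fin n, η / (m * n + 1) :=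
        Finset.sum_le_sum fun i _ => Finset.sum_le_sum fun j _ => hent i j
    _ = (m * n) * (η / (m * n + 1)) := by simp; ring
    _ ≤ η := by
        rw [mul_div_assoc', div_le_iff₀ (by positivity)]
        nlinarith

theorem dist_lt_of_mem_subcube {N : ℕ} (hN : 0 < N) {k : Fin n → Fin N} {x : Fin n → ℝ}
    (hx : x ∈ subcube N k) {δ : ℝ} (hδ : 1 < N * δ) :
    dist x (fun i => ((k i : ℕ) : ℝ) / N) < δ := by
  have hN' : (0 : ℝ) < N := by exact_mod_cast hN
  have hδ0 : 0 < δ := pos_of_mul_pos_right (zero_lt_one.trans hδ) hN'.le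
  rw [dist_pi_lt_iff hδ0]
  intro i
  have h := mem_subcube.1 hx i
  rw [Real.dist_eq, abs_lt]
  have e : x i - ((k i : ℕ) : ℝ) / N = (N * x i - (k i : ℕ)) / N := by field_simp
  rw [e, lt_div_iff₀ hN', div_lt_iff₀ hN']
  constructor <;> nlinarith [h.1, h.2]

theorem isQuasiconvex_quasiconvexEnvelope (h0 : ∀ z, 0 ≤ G z) (hL : 0 ≤ L)
    (hG : ∀ z w, |G z - G w| ≤ L * entrySum (z - w)) : IsQuasiconvex (quasiconvexEnvelope G) := by
  intro z ψ hψ1 hψ2 hψ3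
  have hψ : ψ ∈ cubeTestMaps m n := ⟨hψ1, hψ2, hψ3⟩
  have hQ := abs_quasiconvexEnvelope_sub_le h0 hG
  refine le_of_forall_pos_le_add fun ε hε => ?_
  obtain ⟨η, hη, hηε⟩ : ∃ η > 0, (1 + 2 * L) * η = ε :=
    ⟨ε / (1 + 2 * L), by positivity, by field_simp⟩
  obtain ⟨δ, hδ, hosc⟩ := exists_entrySum_jacobianMatrix_sub_le hψ hη
  obtain ⟨N, hN⟩ := exists_nat_gt δ⁻¹
  have hN' : (0 : ℝ) < N := (inv_pos.2 hδ).trans hN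
  have hN0 : 0 < N := by exact_mod_cast hN'
  have hNδ : 1 < N * δ := by rwa [inv_lt_iff_one_lt_mul₀ hδ] at hN
  set A : (Fin n → Fin N) → Matrix (Fin m) (Fin n) ℝ := fun k =>
    z + jacobianMatrix ψ (fun i => ((k i : ℕ) : ℝ) / N)
  have hex : ∀ k, ∃ φ ∈ cubeTestMaps m n,
      ∫ x in unitCube n, G (A k + jacobianMatrix φ x) ≤ quasiconvexEnvelope G (A k) + η := by
    intro k
    obtain ⟨φ, h⟩ := exists_lt_of_ciInf_lt (lt_add_of_pos_right (quasiconvexEnvelope G (A k)) hη)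
    exact ⟨φ, φ.2, h.le⟩
  choose φ hφ hφle using hex
  have hdiff : ∀ {φ : (Fin n → ℝ) → (Fin m → ℝ)}, φ ∈ cubeTestMaps m n → Differentiable ℝ φ :=
    fun h => h.1.differentiable (by simp)
  have hΦ := superposition_mem_cubeTestMaps hN0 hψ hφ
  have hJ := jacobianMatrix_superposition hN0 (hdiff hψ) fun k => hdiff (hφ k)
  generalize (fun x => ψ x + ∑ k, (N : ℝ)⁻¹ • φ k ((N : ℝ) • x - fun i => ((k i : ℕ) : ℝ))) = Φ
    at hΦ hJ
  have hJk : ∀ k, ∀ x ∈ subcube N k, jacobianMatrix Φ x =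
      jacobianMatrix ψ x + jacobianMatrix (φ k) ((N : ℝ) • x - fun i => ((k i : ℕ) : ℝ)) := by
    intro k x hx
    rw [hJ, Finset.sum_eq_single_of_mem k (Finset.mem_univ k)]
    intro l _ hlk
    refine jacobianMatrix_eq_zero fun hmem => hlk (eq_of_mem_subcube hx fun i => ?_).symm
    have hi := (hφ l).2.2 hmem i (mem_univ i)
    simp only [Pi.sub_apply, Pi.smul_apply, smul_eq_mul, mem_Ioo] at hi
    exact ⟨by linarith [hi.1], by linarith [hi.2]⟩
  have hsubIcc : ∀ k, subcube N k ⊆ Icc 0 1 := fun k =>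
    ((subset_iUnion _ k).trans_eq (iUnion_subcube hN0)).trans (halfOpenCube_subset_Icc n)
  have h_intble : ∀ g : (Fin n → ℝ) → ℝ, Continuous g → ∀ k, IntegrableOn g (subcube N k) :=
    fun g hg k => (hg.continuousOn.integrableOn_compact isCompact_Icc).mono_set (hsubIcc k)
  have hsplit : ∀ g : (Fin n → ℝ) → ℝ, Continuous g →
      ∫ x in unitCube n, g x = ∑ k, ∫ x in subcube N k, g x := by
    intro g hg
    rw [setIntegral_congr_set (unitCube_ae_eq_halfOpenCube n), ← iUnion_subcube hN0]
    refine integral_iUnion_fintype (measurableSet_subcube N) (fun k l hkl => ?_) (h_intble g hg)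
    exact Set.disjoint_left.2 fun x hk hl => hkl (eq_of_mem_subcube hk (mem_subcube.1 hl))
  have hcΦ := continuous_comp_add_jacobianMatrix hG hΦ z
  have hcQ := continuous_comp_add_jacobianMatrix hQ hψ z
  have hcell : ∀ k, ∫ x in subcube N k, G (z + jacobianMatrix Φ x) ≤
      ∫ x in subcube N k, (quasiconvexEnvelope G (z + jacobianMatrix ψ x) + ε) := by
    intro k
    have hck := continuous_comp_add_jacobianMatrix hG (hφ k) (A k)
    have hosck : ∀ x ∈ subcube N k, entrySum (z + jacobianMatrix ψ x - A k) ≤ η ∧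
        entrySum (A k - (z + jacobianMatrix ψ x)) ≤ η := by
      intro x hx
      have hd := dist_lt_of_mem_subcube hN0 hx hNδ
      simp only [A, add_sub_add_left_eq_sub]
      exact ⟨hosc _ _ hd, hosc _ _ (by rwa [dist_comm])⟩
    calc ∫ x in subcube N k, G (z + jacobianMatrix Φ x)
        ≤ ∫ x in subcube N k, (G (A k + jacobianMatrix (φ k)
            ((N : ℝ) • x - fun i => ((k i : ℕ) : ℝ))) + L * η) := by
          refine setIntegral_mono_on (h_intble _ hcΦ k) (h_intble _ (by
            exact (hck.comp (by fun_prop)).add continuous_const) k) (measurableSet_subcube N k)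
            fun x hx => ?_
          rw [hJk k x hx, ← add_assoc]
          have h1 := (abs_le.1 (hG (z + jacobianMatrix ψ x + jacobianMatrix (φ k)
            ((N : ℝ) • x - fun i => ((k i : ℕ) : ℝ))) (A k + jacobianMatrix (φ k)
            ((N : ℝ) • x - fun i => ((k i : ℕ) : ℝ))))).2
          rw [add_sub_add_right_eq_sub] at h1
          have h2 := mul_le_mul_of_nonneg_left (hosck x hx).1 hL
          linarith
      _ = ((N : ℝ) ^ n)⁻¹ * ∫ y in unitCube n, (G (A k + jacobianMatrix (φ k) y) + L * η) :=
          setIntegral_subcube_comp hN0 k fun y => G (A k + jacobianMatrix (φ k) y) + L * η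
      _ ≤ ((N : ℝ) ^ n)⁻¹ * ∫ _ in unitCube n, (quasiconvexEnvelope G (A k) + η + L * η) := by
          refine mul_le_mul_of_nonneg_left ?_ (by positivity)
          rw [integral_add hck.integrableOn_unitCube continuous_const.integrableOn_unitCube,
            setIntegral_unitCube_const, setIntegral_unitCube_const]
          linarith [hφle k]
      _ = ∫ _ in subcube N k, (quasiconvexEnvelope G (A k) + η + L * η) :=
          (setIntegral_subcube_comp hN0 k fun _ => quasiconvexEnvelope G (A k) + η + L * η).symm
      _ ≤ ∫ x in subcube N k, (quasiconvexEnvelope G (z + jacobianMatrix ψ x) + ε) := by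
          refine setIntegral_mono_on (h_intble _ continuous_const k)
            (h_intble _ (hcQ.add continuous_const) k) (measurableSet_subcube N k) fun x hx => ?_
          have h1 := (abs_le.1 (hQ (A k) (z + jacobianMatrix ψ x))).2
          have h2 := mul_le_mul_of_nonneg_left (hosck x hx).2 hL
          linarith
  calc quasiconvexEnvelope G z ≤ ∫ x in unitCube n, G (z + jacobianMatrix Φ x) :=
        quasiconvexEnvelope_le_integral h0 z hΦ
    _ ≤ ∫ x in unitCube n, (quasiconvexEnvelope G (z + jacobianMatrix ψ x) + ε) := by
        rw [hsplit _ hcΦ, hsplit (fun x => quasiconvexEnvelope G (z + jacobianMatrix ψ x) + ε)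
          (hcQ.add continuous_const)]
        exact Finset.sum_le_sum fun k _ => hcell k
    _ = _ := by
        rw [integral_add hcQ.integrableOn_unitCube continuous_const.integrableOn_unitCube,
          setIntegral_unitCube_const]

end Quasiconvex

section Oscillating

theorem abs_min_one_sq_sub_le (a b : ℝ) : |min 1 (a ^ 2) - min 1 (b ^ 2)| ≤ 2 * |a - b| := by
  have h : ∀ t : ℝ, min 1 (t ^ 2) = (min 1 |t|) ^ 2 := by
    intro t
    rcases le_total 1 |t| with ht | ht
    · rw [min_eq_left ht, min_eq_left (by rw [← sq_abs]; nlinarith), one_pow]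
    · rw [min_eq_right ht, sq_abs, min_eq_right (by rw [← sq_abs]; nlinarith [abs_nonneg t])]
  have h1 : |min 1 |a| - min 1 (|b|)| ≤ |a - b| := by
    refine (abs_min_sub_min_le_max _ _ _ _).trans ?_
    rw [sub_self, abs_zero]
    exact max_le (abs_nonneg _) (abs_abs_sub_abs_le _ _)
  have h2 : |min 1 |a| + min 1 (|b|)| ≤ 2 := by
    rw [abs_of_nonneg (by positivity)]
    linarith [min_le_left 1 |a|, min_le_left 1 |b|]
  rw [h, h, sq_sub_sq, abs_mul]
  exact mul_le_mul h2 h1 (abs_nonneg _) zero_le_two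

open Classical in
/-- A bump of height `3 ^ k` centred at `3 ^ k`, present only for `k ∉ Λ`. -/
noncomputable def lacunaryBump (Λ : Set ℕ) (k : ℕ) (t : ℝ) : ℝ :=
  if k ∈ Λ then 0 else 3 ^ k * (1 - min 1 ((3 / 2 * (t / 3 ^ k - 1)) ^ 2))

variable (Λ : Set ℕ)

theorem abs_lacunaryBump_sub_le (k : ℕ) (s t : ℝ) :
    |lacunaryBump Λ k s - lacunaryBump Λ k t| ≤ 3 * |s - t| := by
  unfold lacunaryBump
  split_ifs
  · simp
  have h := abs_min_one_sq_sub_le (3 / 2 * (t / 3 ^ k - 1)) (3 / 2 * (s / 3 ^ k - 1))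
  have e : 3 / 2 * (t / 3 ^ k - 1) - 3 / 2 * (s / 3 ^ k - 1) = 3 / 2 / 3 ^ k * (t - s) := by ring
  rw [e, abs_mul, abs_of_pos (by positivity : (0 : ℝ) < 3 / 2 / 3 ^ k), abs_sub_comm t s] at h
  rw [← mul_sub, sub_sub_sub_cancel_left, abs_mul,
    abs_of_pos (by positivity : (0 : ℝ) < 3 ^ k)]
  refine (mul_le_mul_of_nonneg_left h (by positivity)).trans_eq ?_
  field_simp

theorem lacunaryBump_nonneg (k : ℕ) (t : ℝ) : 0 ≤ lacunaryBump Λ k t := by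
  unfold lacunaryBump
  split_ifs
  · exact le_rfl
  · exact mul_nonneg (by positivity) (sub_nonneg.2 (min_le_left _ _))

theorem lacunaryBump_le (k : ℕ) (t : ℝ) : lacunaryBump Λ k t ≤ 3 * |t| := by
  have h := (abs_le.1 (abs_lacunaryBump_sub_le Λ k t 0)).2
  have h0 : lacunaryBump Λ k 0 = 0 := by norm_num [lacunaryBump]
  rwa [h0, sub_zero, sub_zero] at h

theorem lacunaryBump_pow_eq_zero {j : ℕ} (hj : j ∈ Λ) (k : ℕ) : lacunaryBump Λ k (3 ^ j) = 0 := by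
  unfold lacunaryBump
  split_ifs with hk
  · rfl
  have h3 : ∀ {a b : ℕ}, a < b → (3 : ℝ) * 3 ^ a ≤ 3 ^ b := fun h => by
    rw [← pow_succ']
    exact pow_le_pow_right₀ (by norm_num) h
  have hpos : (0 : ℝ) < 3 ^ k := by positivity
  rw [min_eq_left, sub_self, mul_zero]
  rcases lt_or_gt_of_ne (fun h : k = j => hk (h ▸ hj)) with h | h
  · have h1 : 3 ≤ (3 : ℝ) ^ j / 3 ^ k := (le_div_iff₀ hpos).2 (h3 h)
    nlinarith
  · have h1 : (3 : ℝ) ^ j / 3 ^ k ≤ 1 / 3 := (div_le_iff₀ hpos).2 (by linarith [h3 h])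
    nlinarith

/-- The upper envelope of the bumps. -/
noncomputable def lacunaryProfile (t : ℝ) : ℝ := ⨆ k, lacunaryBump Λ k t

theorem bddAbove_range_lacunaryBump (t : ℝ) : BddAbove (range fun k => lacunaryBump Λ k t) :=
  ⟨3 * |t|, forall_mem_range.2 fun k => lacunaryBump_le Λ k t⟩

theorem lacunaryBump_le_lacunaryProfile (k : ℕ) (t : ℝ) :
    lacunaryBump Λ k t ≤ lacunaryProfile Λ t :=
  le_ciSup (bddAbove_range_lacunaryBump Λ t) k

theorem lacunaryProfile_nonneg (t : ℝ) : 0 ≤ lacunaryProfile Λ t :=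
  (lacunaryBump_nonneg Λ 0 t).trans (lacunaryBump_le_lacunaryProfile Λ 0 t)

theorem abs_lacunaryProfile_sub_le (s t : ℝ) :
    |lacunaryProfile Λ s - lacunaryProfile Λ t| ≤ 3 * |s - t| := by
  have key : ∀ s t, lacunaryProfile Λ s ≤ lacunaryProfile Λ t + 3 * |s - t| := fun s t =>
    ciSup_le fun k => by
      linarith [(abs_le.1 (abs_lacunaryBump_sub_le Λ k s t)).2,
        lacunaryBump_le_lacunaryProfile Λ k t]
  have h := key t s
  rw [abs_sub_comm] at h
  exact abs_le.2 ⟨by linarith, by linarith [key s t]⟩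

theorem lacunaryProfile_pow_eq_zero {j : ℕ} (hj : j ∈ Λ) : lacunaryProfile Λ (3 ^ j) = 0 := by
  simp [lacunaryProfile, lacunaryBump_pow_eq_zero Λ hj]

/-- The distance to the multiples of the identity, weighted by `c`, plus the profile. -/
noncomputable def lacunaryIntegrand (c : ℝ) (z : Matrix (Fin 2) (Fin 2) ℝ) : ℝ :=
  c * (|z 0 1| + |z 1 0| + |z 0 0 - z 1 1|) + lacunaryProfile Λ (z 0 0)

variable {c : ℝ}

theorem lacunaryIntegrand_nonneg (hc : 0 ≤ c) (z : Matrix (Fin 2) (Fin 2) ℝ) :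
    0 ≤ lacunaryIntegrand Λ c z :=
  add_nonneg (by positivity) (lacunaryProfile_nonneg Λ _)

theorem lacunaryIntegrand_pow_smul_one {j : ℕ} (hj : j ∈ Λ) :
    lacunaryIntegrand Λ c ((3 : ℝ) ^ j • (1 : Matrix (Fin 2) (Fin 2) ℝ)) = 0 := by
  simp [lacunaryIntegrand, lacunaryProfile_pow_eq_zero Λ hj]

theorem abs_lacunaryIntegrand_sub_le (hc : 0 ≤ c) (z w : Matrix (Fin 2) (Fin 2) ℝ) :
    |lacunaryIntegrand Λ c z - lacunaryIntegrand Λ c w| ≤ (c + 3) * entrySum (z - w) := by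
  have h1 := abs_lacunaryProfile_sub_le Λ (z 0 0) (w 0 0)
  have h2 := abs_abs_sub_abs_le (z 0 1) (w 0 1)
  have h3 := abs_abs_sub_abs_le (z 1 0) (w 1 0)
  have h4 := abs_abs_sub_abs_le (z 0 0 - z 1 1) (w 0 0 - w 1 1)
  have h5 : |z 0 0 - z 1 1 - (w 0 0 - w 1 1)| ≤ |z 0 0 - w 0 0| + |z 1 1 - w 1 1| := by
    rw [sub_sub_sub_comm]
    exact norm_sub_le (E := ℝ) _ _
  have h6 : |(|z 0 1| + |z 1 0| + |z 0 0 - z 1 1|) - (|w 0 1| + |w 1 0| + |w 0 0 - w 1 1|)| ≤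
      entrySum (z - w) := by
    simp only [entrySum, Fin.sum_univ_two, Matrix.sub_apply]
    rw [abs_le] at h2 h3 h4 ⊢
    constructor <;> linarith [h2.1, h2.2, h3.1, h3.2, h4.1, h4.2]
  have h7 : |z 0 0 - w 0 0| ≤ entrySum (z - w) := by
    simp only [entrySum, Fin.sum_univ_two, Matrix.sub_apply]
    linarith [abs_nonneg (z 0 1 - w 0 1), abs_nonneg (z 1 0 - w 1 0), abs_nonneg (z 1 1 - w 1 1)]
  unfold lacunaryIntegrand
  rw [add_sub_add_comm, ← mul_sub]
  refine (abs_add_le _ _).trans ?_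
  rw [abs_mul, abs_of_nonneg hc]
  linarith [mul_le_mul_of_nonneg_left h6 hc]

theorem entrySum_le_mul_frobNorm {m n : ℕ} (z : Matrix (Fin m) (Fin n) ℝ) :
    entrySum z ≤ m * n * frobNorm z := by
  have h : ∀ i j, |z i j| ≤ frobNorm z := fun i j => by
    rw [← Real.sqrt_sq_eq_abs]
    refine Real.sqrt_le_sqrt ?_
    exact (Finset.single_le_sum (f := fun j => z i j ^ 2) (fun _ _ => sq_nonneg _)
      (Finset.mem_univ j)).trans (Finset.single_le_sum (f := fun i => ∑ j, z i j ^ 2)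
        (fun _ _ => Finset.sum_nonneg fun _ _ => sq_nonneg _) (Finset.mem_univ i))
  refine (Finset.sum_le_sum fun i _ => Finset.sum_le_sum fun j _ => h i j).trans_eq ?_
  simp [mul_assoc]

theorem pow_le_quasiconvexEnvelope_lacunaryIntegrand {C : ℝ} (hC0 : 0 ≤ C)
    (hC : ∀ u v : (Fin 2 → ℝ) → ℝ, ContDiff ℝ 1 u → ContDiff ℝ 1 v → HasCompactSupport u →
      HasCompactSupport v →
      ∫ x, min 1 (fderiv ℝ u x (Pi.single 0 1) ^ 2) ≤ C * ∫ x, transversalGradient u v x)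
    {k : ℕ} (hk : k ∉ Λ) :
    3 ^ k ≤ quasiconvexEnvelope (lacunaryIntegrand Λ (3 / 2 * C))
      ((3 : ℝ) ^ k • (1 : Matrix (Fin 2) (Fin 2) ℝ)) := by
  refine le_ciInf fun ⟨φ, hφ⟩ => ?_
  have hc : 0 ≤ 3 / 2 * C := by positivity
  have hφ1 : ContDiff ℝ 1 φ := hφ.1.of_le (by exact_mod_cast le_top)
  set s : ℝ := 3 / 2 / 3 ^ k with hs
  have hspos : 0 < s := by positivity
  set w : Fin 2 → (Fin 2 → ℝ) → ℝ := fun i x => s * φ x i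
  have hw : ∀ i, ContDiff ℝ 1 (w i) := fun i => by fun_prop
  have hwzero : ∀ i, ∀ x ∉ tsupport φ, w i x = 0 := fun i x hx => by
    simp [w, image_eq_zero_of_notMem_tsupport hx]
  have hwc : ∀ i, HasCompactSupport (w i) := fun i =>
    HasCompactSupport.intro hφ.2.1.isCompact (hwzero i)
  have hwd : ∀ i j x, fderiv ℝ (w i) x (Pi.single j 1) = s * jacobianMatrix φ x i j := by
    intro i j x
    have h1 := (hφ1.differentiable one_ne_zero x).hasFDerivAt
    have h2 : HasFDerivAt (w i) _ x := ((hasFDerivAt_pi'.1 h1 i).const_mul s)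
    rw [h2.fderiv]
    simp [jacobianMatrix]
  have hT : ∀ x, transversalGradient (w 0) (w 1) x = s * (|jacobianMatrix φ x 0 1| +
      |jacobianMatrix φ x 1 0| + |jacobianMatrix φ x 0 0 - jacobianMatrix φ x 1 1|) := by
    intro x
    simp only [transversalGradient, hwd, ← mul_sub, abs_mul, abs_of_pos hspos]
    ring
  have hTc := continuous_transversalGradient (hw 0) (hw 1)
  have hTi : ∫ x in unitCube 2, transversalGradient (w 0) (w 1) x =
      ∫ x, transversalGradient (w 0) (w 1) x :=
    setIntegral_eq_integral_of_forall_compl_eq_zero fun x hx => by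
      simp [hT, jacobianMatrix_eq_zero fun h => hx (hφ.2.2 h)]
  have hmc : Continuous fun x => min 1 (fderiv ℝ (w 0) x (Pi.single 0 1) ^ 2) := by
    have := (hw 0).continuous_fderiv one_ne_zero
    fun_prop
  have hmi : ∫ x in unitCube 2, min 1 (fderiv ℝ (w 0) x (Pi.single 0 1) ^ 2) =
      ∫ x, min 1 (fderiv ℝ (w 0) x (Pi.single 0 1) ^ 2) :=
    setIntegral_eq_integral_of_forall_compl_eq_zero fun x hx => by
      simp [hwd, jacobianMatrix_eq_zero fun h => hx (hφ.2.2 h)]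
  have hest := hC (w 0) (w 1) (hw 0) (hw 1) (hwc 0) (hwc 1)
  have hpt : ∀ x, (3 : ℝ) ^ k * (C * transversalGradient (w 0) (w 1) x +
      (1 - min 1 (fderiv ℝ (w 0) x (Pi.single 0 1) ^ 2))) ≤
      lacunaryIntegrand Λ (3 / 2 * C) ((3 : ℝ) ^ k • (1 : Matrix (Fin 2) (Fin 2) ℝ) +
        jacobianMatrix φ x) := by
    intro x
    have h := lacunaryBump_le_lacunaryProfile Λ k (3 ^ k + jacobianMatrix φ x 0 0)
    have e : 3 / 2 * ((3 ^ k + jacobianMatrix φ x 0 0) / 3 ^ k - 1) =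
        s * jacobianMatrix φ x 0 0 := by
      rw [hs]; field_simp; ring
    rw [lacunaryBump, if_neg hk, e] at h
    have e2 : (3 : ℝ) ^ k * (C * s) = 3 / 2 * C := by
      rw [hs]; field_simp
    simp only [lacunaryIntegrand, hT, hwd, Matrix.add_apply, Matrix.smul_apply, Matrix.one_apply,
      smul_eq_mul]
    norm_num
    rw [← e2]
    linarith
  have h3 : (0 : ℝ) < 3 ^ k := by positivity
  have hci : Continuous fun x => (3 : ℝ) ^ k * (C * transversalGradient (w 0) (w 1) x +
      (1 - min 1 (fderiv ℝ (w 0) x (Pi.single 0 1) ^ 2))) := by fun_prop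
  refine le_trans ?_ (integral_mono hci.integrableOn_unitCube
    (continuous_comp_add_jacobianMatrix (abs_lacunaryIntegrand_sub_le Λ hc) hφ
      _).integrableOn_unitCube hpt)
  have hm1 : IntegrableOn (fun x => 1 - min 1 (fderiv ℝ (w 0) x (Pi.single 0 1) ^ 2))
      (unitCube 2) := (continuous_const.sub hmc).integrableOn_unitCube
  rw [integral_const_mul, integral_add (hTc.integrableOn_unitCube.const_mul C) hm1, integral_const_mul, hTi,
    integral_sub continuous_const.integrableOn_unitCube hmc.integrableOn_unitCube,
    setIntegral_unitCube_const, hmi]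
  nlinarith

end Oscillating

theorem exists_quasiconvex_oscillating_along :
    ∃ c > (0 : ℝ), ∀ Λ : Set ℕ, Λ.Infinite → Λᶜ.Infinite →
      ∃ f : Matrix (Fin 2) (Fin 2) ℝ → ℝ,
        Continuous f ∧ IsQuasiconvex f ∧ HasLinearGrowth f ∧
        (∀ j ∈ Λ, f ((3 : ℝ) ^ j • (1 : Matrix (Fin 2) (Fin 2) ℝ)) = 0) ∧
        ∃ J : ℕ, ∀ j ∉ Λ, J ≤ j →
          c * 3 ^ j ≤ f ((3 : ℝ) ^ j • (1 : Matrix (Fin 2) (Fin 2) ℝ)) := by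
  obtain ⟨C, hC0, hC⟩ := exists_integral_min_one_sq_fderiv_le
  refine ⟨1, one_pos, fun Λ _ _ => ?_⟩
  have hc : 0 ≤ 3 / 2 * C := by positivity
  have h0 := lacunaryIntegrand_nonneg Λ hc
  have hL := abs_lacunaryIntegrand_sub_le Λ hc
  have hQ := abs_quasiconvexEnvelope_sub_le h0 hL
  have hzero : ∀ j ∈ Λ, quasiconvexEnvelope (lacunaryIntegrand Λ (3 / 2 * C))
      ((3 : ℝ) ^ j • (1 : Matrix (Fin 2) (Fin 2) ℝ)) = 0 := fun j hj =>
    le_antisymm ((quasiconvexEnvelope_le h0 _).trans_eq (lacunaryIntegrand_pow_smul_one Λ hj))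
      (quasiconvexEnvelope_nonneg h0 _)
  refine ⟨quasiconvexEnvelope (lacunaryIntegrand Λ (3 / 2 * C)),
    continuous_of_abs_sub_le_entrySum hQ, isQuasiconvex_quasiconvexEnvelope h0 (by positivity) hL,
    ?_, hzero, 0, fun j hj _ => ?_⟩
  · set K := quasiconvexEnvelope (lacunaryIntegrand Λ (3 / 2 * C)) 0
    have hK : 0 ≤ K := quasiconvexEnvelope_nonneg h0 0
    refine ⟨K + 4 * (3 / 2 * C + 3), by positivity, fun z => ?_⟩
    have h1 := hQ z 0
    rw [sub_zero] at h1
    have h2 := mul_le_mul_of_nonneg_left (entrySum_le_mul_frobNorm z)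
      (by positivity : 0 ≤ 3 / 2 * C + 3)
    push_cast at h2
    have h3 : 0 ≤ frobNorm z := Real.sqrt_nonneg _
    rw [abs_of_nonneg (quasiconvexEnvelope_nonneg h0 z)]
    nlinarith [(abs_le.1 h1).2, mul_nonneg hK h3]
  · rw [one_mul]
    exact pow_le_quasiconvexEnvelope_lacunaryIntegrand Λ hC0 hC hj
end

section
/- Let Ω ⊆ ℝⁿ be open and bounded, μ a finite positive Borel measure on Ω, and (u_j) a bounded sequence in L¹(Ω,μ;ℝ^d). Let (ν_x)_{x∈Ω} be a μ-measurable family of Borel probability measures on ℝ^d (a Markov kernel) such that for every ψ ∈ C₀(ℝ^d) (continuous vanishing at infinity), ψ ∘ u_j converges to the function x ↦ ∫_{ℝ^d} ψ dν_x weakly in L¹(μ), i.e. ∫ b·ψ(u_j) dμ → ∫ b(x) (∫ ψ dν_x) dμ(x) for every bounded measurable b : Ω → ℝ. Then for every a ∈ L¹(Ω,μ) with a > 0 μ-almost everywhere and every ψ ∈ C₀(ℝ^d), the functions x ↦ ψ(u_j(x)/a(x))·a(x) converge weakly in L¹(μ) to the function x ↦ (∫_{ℝ^d} ψ(w/a(x))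 dν_x(w))·a(x); that is, ∫ b·ψ(u_j/a)·a dμ → ∫ b(x) (∫ ψ(w/a(x)) dν_x(w)) a(x) dμ(x) for every bounded measurable b. -/
open MeasureTheory Filter

/-- A continuous function vanishing at infinity. -/
def VanishesAtInfty {d : ℕ} (ψ : EuclideanSpace ℝ (Fin d) → ℝ) : Prop :=
  Continuous ψ ∧ Tendsto ψ (cocompact (EuclideanSpace ℝ (Fin d))) (nhds 0)

open scoped ZeroAtInfty Topology

section RandomFunctionals

variable {X V : Type*} [MeasurableSpace X] {μ : Measure X} [NormedAddCommGroup V] [NormedSpace ℝ V]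

/-- Applying a weakly measurable random functional to a strongly measurable function gives a
measurable function. -/
theorem aestronglyMeasurable_functional_apply {T : X → V →L[ℝ] ℝ}
    (hT : ∀ v, AEStronglyMeasurable (fun x => T x v) μ) {f : X → V}
    (hf : AEStronglyMeasurable f μ) : AEStronglyMeasurable (fun x => T x (f x)) μ := by
  have key : ∀ g : X → V, StronglyMeasurable g →
      AEStronglyMeasurable (fun x => T x (g x)) μ := by
    intro g hg
    induction g, hg using StronglyMeasurable.induction with
    | ind c hs =>
      rename_i s
      refine ((hT c).indicator hs).congr (ae_of_all _ fun x => ?_)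
      by_cases hx : x ∈ s <;> simp [hx]
    | add _ _ _ _ ihf ihg =>
      simp only [Pi.add_apply, map_add]
      exact ihf.add ihg
    | lim _ _ ih hlim =>
      exact aestronglyMeasurable_of_tendsto_ae atTop ih
        (ae_of_all _ fun x => ((T x).continuous.tendsto _).comp (hlim x))
  refine (key _ hf.stronglyMeasurable_mk).congr ?_
  filter_upwards [hf.ae_eq_mk] with x hx
  rw [← hx]

theorem integrable_functional_apply {T : X → V →L[ℝ] ℝ} (hT : ∀ x, ‖T x‖ ≤ 1)
    (hTm : ∀ v, AEStronglyMeasurable (fun x => T x v) μ) {f : X → V} (hf : Integrable f μ) :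
    Integrable (fun x => T x (f x)) μ :=
  hf.mono (aestronglyMeasurable_functional_apply hTm hf.1)
    (ae_of_all _ fun x => by
      simpa using (T x).le_of_opNorm_le (hT x) (f x))

theorem lipschitzWith_integral_functional_apply {T : X → V →L[ℝ] ℝ} (hT : ∀ x, ‖T x‖ ≤ 1)
    (hTm : ∀ v, AEStronglyMeasurable (fun x => T x v) μ) :
    LipschitzWith 1 fun f : X →₁[μ] V => ∫ x, T x (f x) ∂μ := by
  refine LipschitzWith.of_dist_le_mul fun f g => ?_
  have hf := L1.integrable_coeFn f
  have hg := L1.integrable_coeFn g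
  rw [NNReal.coe_one, one_mul, dist_eq_norm, dist_eq_norm, L1.norm_eq_integral_norm,
    ← integral_sub (integrable_functional_apply hT hTm hf) (integrable_functional_apply hT hTm hg)]
  refine (norm_integral_le_of_norm_le (hf.sub hg).norm (ae_of_all _ fun x => ?_)).trans_eq
    (integral_congr_ae ?_)
  · rw [← map_sub]
    simpa using (T x).le_of_opNorm_le (hT x) (f x - g x)
  · filter_upwards [Lp.coeFn_sub f g] with x hx
    rw [hx]

/-- Convergence of contractive random functionals against indicators of measurable sets upgrades to
convergence against every Bochner integrable function. -/
theorem tendsto_integral_functional_apply {T : ℕ → X → V →L[ℝ] ℝ} {S : X → V →L[ℝ] ℝ}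
    (hT : ∀ j x, ‖T j x‖ ≤ 1) (hS : ∀ x, ‖S x‖ ≤ 1)
    (hTm : ∀ j v, AEStronglyMeasurable (fun x => T j x v) μ)
    (hSm : ∀ v, AEStronglyMeasurable (fun x => S x v) μ)
    (hlim : ∀ v s, MeasurableSet s →
      Tendsto (fun j => ∫ x in s, T j x v ∂μ) atTop (𝓝 (∫ x in s, S x v ∂μ)))
    {f : X → V} (hf : Integrable f μ) :
    Tendsto (fun j => ∫ x, T j x (f x) ∂μ) atTop (𝓝 (∫ x, S x (f x) ∂μ)) := by
  refine Integrable.induction (μ := μ) (fun f : X → V =>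
    Tendsto (fun j => ∫ x, T j x (f x) ∂μ) atTop (𝓝 (∫ x, S x (f x) ∂μ))) ?_ ?_ ?_ ?_ hf
  · intro c s hs _
    have h : ∀ R : X → V →L[ℝ] ℝ,
        ∫ x, R x (s.indicator (fun _ => c) x) ∂μ = ∫ x in s, R x c ∂μ := by
      intro R
      rw [← integral_indicator hs]
      refine integral_congr_ae (ae_of_all _ fun x => ?_)
      by_cases hx : x ∈ s <;> simp [hx]
    simpa only [h] using hlim c s hs
  · intro f g _ hf hg ihf ihg
    have h : ∀ R : X → V →L[ℝ] ℝ, (∀ x, ‖R x‖ ≤ 1) →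
        (∀ v, AEStronglyMeasurable (fun x => R x v) μ) →
        ∫ x, R x ((f + g) x) ∂μ = ∫ x, R x (f x) ∂μ + ∫ x, R x (g x) ∂μ := by
      intro R hR hRm
      rw [← integral_add (integrable_functional_apply hR hRm hf)
        (integrable_functional_apply hR hRm hg)]
      simp only [Pi.add_apply, map_add]
    rw [h S hS hSm]
    simp only [fun j => h (T j) (hT j) (hTm j)]
    exact ihf.add ihg
  · exact Equicontinuous.isClosed_setOfPred_tendsto
      (LipschitzWith.uniformEquicontinuous _ 1 fun j =>
        lipschitzWith_integral_functional_apply (hT j) (hTm j)).equicontinuous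
      (lipschitzWith_integral_functional_apply hS hSm).continuous
  · intro f g hfg _ ih
    have h : ∀ R : X → V →L[ℝ] ℝ, ∫ x, R x (f x) ∂μ = ∫ x, R x (g x) ∂μ := fun R =>
      integral_congr_ae (hfg.mono fun x hx => congrArg (R x) hx)
    simpa only [h] using ih

end RandomFunctionals

namespace ZeroAtInftyContinuousMap

section Functionals

variable {E : Type*} [TopologicalSpace E]

theorem norm_apply_le (φ : C₀(E, ℝ)) (w : E) : ‖φ w‖ ≤ ‖φ‖ :=
  φ.toBCF.norm_coe_le_norm w

variable [MeasurableSpace E] [OpensMeasurableSpace E]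

/-- Integration against a probability measure, as a functional on `C₀`. -/
noncomputable def integralCLM (P : Measure E) [IsProbabilityMeasure P] : C₀(E, ℝ) →L[ℝ] ℝ :=
  LinearMap.mkContinuous
    { toFun := fun φ => ∫ w, φ w ∂P
      map_add' := fun φ χ => integral_add (φ.toBCF.integrable P) (χ.toBCF.integrable P)
      map_smul' := fun c φ => integral_const_mul c _ } 1 fun φ => by
    simpa using norm_integral_le_of_norm_le_const (μ := P) (ae_of_all P φ.norm_apply_le)

@[simp]
theorem integralCLM_apply (P : Measure E) [IsProbabilityMeasure P] (φ : C₀(E, ℝ)) :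
    integralCLM P φ = ∫ w, φ w ∂P := rfl

theorem norm_integralCLM_le (P : Measure E) [IsProbabilityMeasure P] :
    ‖(integralCLM P : C₀(E, ℝ) →L[ℝ] ℝ)‖ ≤ 1 :=
  LinearMap.mkContinuous_norm_le _ zero_le_one _

end Functionals

section Dilation

variable {E : Type*} [NormedAddCommGroup E] [NormedSpace ℝ E]

/-- The dilation `w ↦ φ (s • w)` of `φ` for `s ≠ 0`, with junk value `0` at `s = 0`. -/
noncomputable def dilation (φ : C₀(E, ℝ)) (s : ℝ) : C₀(E, ℝ) :=
  if hs : s = 0 then 0 else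
    { toFun := fun w => φ (s • w)
      continuous_toFun := φ.continuous.comp (continuous_const_smul s)
      zero_at_infty' := (zero_at_infty φ).comp
        (Homeomorph.smulOfNeZero s hs).isClosedEmbedding.tendsto_cocompact }

theorem dilation_apply (φ : C₀(E, ℝ)) {s : ℝ} (hs : s ≠ 0) (w : E) :
    φ.dilation s w = φ (s • w) := by
  rw [dilation, dif_neg hs]
  rfl

theorem norm_dilation_le (φ : C₀(E, ℝ)) (s : ℝ) : ‖φ.dilation s‖ ≤ ‖φ‖ := by
  by_cases hs : s = 0
  · simp [dilation, hs]
  · rw [← norm_toBCF_eq_norm]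
    refine (BoundedContinuousFunction.norm_le (norm_nonneg φ)).2 fun w => ?_
    change ‖φ.dilation s w‖ ≤ ‖φ‖
    rw [dilation_apply φ hs]
    exact φ.norm_apply_le _

theorem continuousOn_dilation [ProperSpace E] (φ : C₀(E, ℝ)) :
    ContinuousOn φ.dilation {0}ᶜ := by
  intro s (hs : s ≠ 0)
  refine ContinuousAt.continuousWithinAt ?_
  rw [ContinuousAt, tendsto_iff_tendstoUniformly, Metric.tendstoUniformly_iff]
  intro ε hε
  obtain ⟨δ, hδ, hφδ⟩ := Metric.uniformContinuous_iff.1 (uniformContinuous φ) ε hε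
  obtain ⟨r, hr⟩ : ∃ r : ℝ, ∀ w : E, r < ‖w‖ → ‖φ w‖ < ε / 2 := by
    have h := (zero_at_infty φ).norm.eventually_lt_const (u := ε / 2)
      (by simpa only [norm_zero] using half_pos hε)
    rw [← Metric.cobounded_eq_cocompact, ← comap_norm_atTop, eventually_comap] at h
    obtain ⟨r, hr⟩ := eventually_atTop.1 h
    exact ⟨r, fun w hw => hr _ hw.le w rfl⟩
  have hs' : 0 < |s| := abs_pos.2 hs
  set R := 2 * (|r| + 1) / |s| with hR
  have hRpos : 0 < R := by positivity
  filter_upwards [Metric.ball_mem_nhds s (lt_min (half_pos hs') (div_pos hδ hRpos))] with t ht w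
  rw [Metric.mem_ball, lt_min_iff, Real.dist_eq] at ht
  have htabs : |s| / 2 < |t| := by
    have := abs_sub_abs_le_abs_sub s t
    rw [abs_sub_comm] at this
    linarith [ht.1]
  have ht0 : t ≠ 0 := abs_pos.1 ((half_pos hs').trans htabs)
  rw [dilation_apply φ hs, dilation_apply φ ht0]
  rcases le_or_gt ‖w‖ R with hw | hw
  · refine hφδ ?_
    rw [dist_eq_norm, ← sub_smul, norm_smul, Real.norm_eq_abs, abs_sub_comm]
    calc |t - s| * ‖w‖ ≤ |t - s| * R := by gcongr
      _ < δ := (lt_div_iff₀ hRpos).1 ht.2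
  · have far : ∀ q : ℝ, |s| / 2 ≤ |q| → ‖φ (q • w)‖ < ε / 2 := by
      intro q hq
      refine hr _ ?_
      rw [norm_smul, Real.norm_eq_abs]
      calc r < |r| + 1 := (le_abs_self r).trans_lt (lt_add_one _)
        _ = |s| / 2 * R := by rw [hR]; field_simp
        _ ≤ |q| * ‖w‖ := by gcongr
    calc dist (φ (s • w)) (φ (t • w)) ≤ ‖φ (s • w)‖ + ‖φ (t • w)‖ := dist_le_norm_add_norm _ _
      _ < ε / 2 + ε / 2 := add_lt_add (far s (by linarith)) (far t htabs.le)
      _ = ε := add_halves ε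

theorem aestronglyMeasurable_dilation [ProperSpace E] {X : Type*} [MeasurableSpace X]
    {μ : Measure X} (φ : C₀(E, ℝ)) {f : X → ℝ} (hf : AEMeasurable f μ) (hf0 : ∀ᵐ x ∂μ, f x ≠ 0) :
    AEStronglyMeasurable (fun x => φ.dilation (f x)) μ := by
  have h : AEStronglyMeasurable φ.dilation (μ.map f) := by
    have hmem : ∀ᵐ s ∂μ.map f, s ∈ ({0}ᶜ : Set ℝ) :=
      (ae_map_iff hf (measurableSet_singleton 0).compl).2 hf0
    rw [← Measure.restrict_eq_self_of_ae_mem hmem]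
    exact φ.continuousOn_dilation.aestronglyMeasurable (measurableSet_singleton 0).compl
  exact h.comp_aemeasurable hf

end Dilation

end ZeroAtInftyContinuousMap

/-- If `ψ(u_j) ⇀ ⟨ν_x, ψ⟩` weakly in `L¹(μ)` for all `ψ ∈ C₀(ℝ^d)`, then for every
`a ∈ L¹(μ)` with `a > 0` a.e. and every `ψ ∈ C₀(ℝ^d)`,
`ψ(u_j/a)·a ⇀ ⟨ν_x, ψ(·/a(x))⟩·a` weakly in `L¹(μ)`. -/
theorem oscillation_independent_of_weight {n d : ℕ}
    (Ω : Set (EuclideanSpace ℝ (Fin n))) (hΩo : IsOpen Ω) (hΩb : Bornology.IsBounded Ω)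
    (μ : Measure (EuclideanSpace ℝ (Fin n))) [IsFiniteMeasure μ]
    (u : ℕ → EuclideanSpace ℝ (Fin n) → EuclideanSpace ℝ (Fin d))
    (hu_int : ∀ j, Integrable (u j) (μ.restrict Ω))
    (hu_bdd : ∃ C : ℝ, ∀ j, ∫ x in Ω, ‖u j x‖ ∂μ ≤ C)
    (ν : EuclideanSpace ℝ (Fin n) → Measure (EuclideanSpace ℝ (Fin d)))
    (hνprob : ∀ x, IsProbabilityMeasure (ν x))
    (hνmeas : ∀ ψ : EuclideanSpace ℝ (Fin d) → ℝ, VanishesAtInfty ψ →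
      Measurable fun x => ∫ w, ψ w ∂ν x)
    (hweak : ∀ ψ : EuclideanSpace ℝ (Fin d) → ℝ, VanishesAtInfty ψ →
      ∀ b : EuclideanSpace ℝ (Fin n) → ℝ, Measurable b → (∃ Mb : ℝ, ∀ x, |b x| ≤ Mb) →
      Tendsto (fun j => ∫ x in Ω, b x * ψ (u j x) ∂μ) atTop
        (nhds (∫ x in Ω, b x * ∫ w, ψ w ∂ν x ∂μ)))
    (a : EuclideanSpace ℝ (Fin n) → ℝ)
    (ha_int : IntegrableOn a Ω μ)
    (ha_pos : ∀ᵐ x ∂μ.restrict Ω, 0 < a x) :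
    ∀ ψ : EuclideanSpace ℝ (Fin d) → ℝ, VanishesAtInfty ψ →
      ∀ b : EuclideanSpace ℝ (Fin n) → ℝ, Measurable b → (∃ Mb : ℝ, ∀ x, |b x| ≤ Mb) →
      Tendsto (fun j => ∫ x in Ω, b x * (ψ ((a x)⁻¹ • u j x) * a x) ∂μ) atTop
        (nhds (∫ x in Ω, b x * ((∫ w, ψ ((a x)⁻¹ • w) ∂ν x) * a x) ∂μ)) := by
  intro ψ hψ b hb hbM
  have := hνprob
  obtain ⟨M, hM⟩ := hbM
  let φ : C₀(EuclideanSpace ℝ (Fin d), ℝ) := ⟨⟨ψ, hψ.1⟩, hψ.2⟩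
  have vanishes (χ : C₀(EuclideanSpace ℝ (Fin d), ℝ)) : VanishesAtInfty χ :=
    ⟨χ.continuous, χ.zero_at_infty'⟩
  have hΦ : Integrable (fun x => (b x * a x) • φ.dilation (a x)⁻¹) (μ.restrict Ω) := by
    have hba : Integrable (fun x => b x * a x) (μ.restrict Ω) :=
      ha_int.bdd_mul hb.aestronglyMeasurable (ae_of_all _ hM)
    refine (hba.norm.mul_const ‖φ‖).mono' (hba.1.smul ?_) (ae_of_all _ fun x => ?_)
    · exact φ.aestronglyMeasurable_dilation ha_int.1.aemeasurable.inv
        (ha_pos.mono fun x hx => inv_ne_zero hx.ne')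
    · rw [norm_smul]
      gcongr
      exact φ.norm_dilation_le _
  have key := tendsto_integral_functional_apply (μ := μ.restrict Ω)
    (T := fun j x => ZeroAtInftyContinuousMap.integralCLM (Measure.dirac (u j x)))
    (S := fun x => ZeroAtInftyContinuousMap.integralCLM (ν x))
    (fun _ _ => ZeroAtInftyContinuousMap.norm_integralCLM_le _)
    (fun _ => ZeroAtInftyContinuousMap.norm_integralCLM_le _)
    (fun j χ => by
      simpa using χ.continuous.comp_aestronglyMeasurable (hu_int j).1)
    (fun χ => (hνmeas χ (vanishes χ)).aestronglyMeasurable)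
    (fun χ s hs => by
      have h := hweak χ (vanishes χ) (s.indicator 1) (measurable_one.indicator hs)
        ⟨1, fun x => by by_cases hx : x ∈ s <;> simp [hx]⟩
      have ind (g : EuclideanSpace ℝ (Fin n) → ℝ) :
          ∫ x in Ω, s.indicator 1 x * g x ∂μ = ∫ x in s, g x ∂μ.restrict Ω := by
        rw [← integral_indicator hs]
        refine integral_congr_ae (ae_of_all _ fun x => ?_)
        by_cases hx : x ∈ s <;> simp [hx]
      simpa [ind] using h) hΦ
  have unfold_dilation (P : EuclideanSpace ℝ (Fin n) → Measure (EuclideanSpace ℝ (Fin d)))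
      [∀ x, IsProbabilityMeasure (P x)] :
      ∫ x in Ω, ZeroAtInftyContinuousMap.integralCLM (P x)
        ((b x * a x) • φ.dilation (a x)⁻¹) ∂μ =
      ∫ x in Ω, b x * ((∫ w, ψ ((a x)⁻¹ • w) ∂P x) * a x) ∂μ := by
    refine integral_congr_ae (ha_pos.mono fun x hx => ?_)
    simp only [map_smul, smul_eq_mul, ZeroAtInftyContinuousMap.integralCLM_apply,
      φ.dilation_apply (inv_ne_zero hx.ne')]
    change b x * a x * ∫ w, ψ ((a x)⁻¹ • w) ∂P x = _
    ring
  simpa only [unfold_dilation, integral_dirac] using key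
end
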